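/- arXiv:1508.07435 — 13 statements merged into one kernel-verified Lean document; each statement's English description precedes it below -/
import Mathlib

section
/- Let a, b ≥ 0 and let ν ∈ Sym3 satisfy ω₁(ν) ≤ a, ω₃(ν) ≥ −b and trace(ν) = a − b. Then for every τ ∈ Sym3 one has ⟨ν, τ⟩ ≤ a·ω₁(τ) − b·ω₃(τ). -/
open Matrix

/-- The space of 3×3 real matrices. -/
abbrev Mat3 := Matrix (Fin 3) (Fin 3) ℝ

/-- The Frobenius inner product ⟨A,B⟩ = trace (A·B). -/
noncomputable def frob (A B : Mat3) : ℝ := (A * B).trace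

/-- Eigenvalues of a symmetric (Hermitian) 3×3 real matrix, sorted in decreasing order:
`ordEig A 0 ≥ ordEig A 1 ≥ ordEig A 2`.  Junk value `0` if `A` is not symmetric. -/
noncomputable def ordEig (A : Mat3) (i : Fin 3) : ℝ :=
  if h : A.IsHermitian then
    (List.insertionSort (· ≥ ·) (List.ofFn h.eigenvalues)).getD i.1 0
  else 0

/-- ω₁: the largest eigenvalue. -/
noncomputable def ω₁ (A : Mat3) : ℝ := ordEig A 0
/-- ω₂: the middle eigenvalue. -/
noncomputable def ω₂ (A : Mat3) : ℝ := ordEig A 1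
/-- ω₃: the smallest eigenvalue. -/
noncomputable def ω₃ (A : Mat3) : ℝ := ordEig A 2

/-- The subdifferential (relative to the space of symmetric matrices) of `g` at `η`. -/
def subdiff (g : Mat3 → ℝ) (η : Mat3) : Set Mat3 :=
  {ν | ν.IsHermitian ∧ ∀ τ : Mat3, τ.IsHermitian → g η + frob ν (τ - η) ≤ g τ}

/-- `V(η)`: admissible ordered orthonormal eigenbases of `η`. -/
def Vset (η : Mat3) : Set (Fin 3 → (Fin 3 → ℝ)) :=
  {e | (∀ i j, e i ⬝ᵥ e j = if i = j then (1 : ℝ) else 0) ∧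
       (∀ i, η.mulVec (e i) = ordEig η i • e i)}


lemma ordEig_bounds (A : Mat3) (h : A.IsHermitian) (i : Fin 3) :
    ω₃ A ≤ h.eigenvalues i ∧ h.eigenvalues i ≤ ω₁ A := by
  unfold ω₃ ω₁ ordEig
  simp only [dif_pos h]
  have hp : (List.insertionSort (· ≥ ·) (List.ofFn h.eigenvalues)).Pairwise (· ≥ ·) :=
    List.pairwise_insertionSort _ _
  have hl : (List.insertionSort (· ≥ ·) (List.ofFn h.eigenvalues)).length = 3 := by
    rw [List.length_insertionSort, List.length_ofFn]
  have hm : h.eigenvalues i ∈ List.insertionSort (· ≥ ·) (List.ofFn h.eigenvalues) := by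
    rw [List.mem_insertionSort, List.mem_ofFn]
    exact ⟨i, rfl⟩
  generalize List.insertionSort (· ≥ ·) (List.ofFn h.eigenvalues) = l at *
  obtain ⟨x, y, z, rfl⟩ := List.length_eq_three.mp hl
  simp at hp hm ⊢
  obtain ⟨⟨h1, h2⟩, h3⟩ := hp
  rcases hm with e | e | e <;> rw [e] <;> constructor <;> linarith

lemma diag_eq (A : Mat3) (h : A.IsHermitian) :
    ∃ U : Mat3, U * Uᵀ = 1 ∧ Uᵀ * U = 1 ∧ A = U * diagonal h.eigenvalues * Uᵀ := by
  refine ⟨h.eigenvectorUnitary, ?_, ?_, ?_⟩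
  · have := Unitary.coe_mul_star_self h.eigenvectorUnitary
    simpa [star_eq_conjTranspose] using this
  · have := Unitary.coe_star_mul_self h.eigenvectorUnitary
    simpa [star_eq_conjTranspose] using this
  · have := h.spectral_theorem
    rw [Unitary.conjStarAlgAut_apply] at this
    simpa [star_eq_conjTranspose, Function.comp_def] using this

lemma scalar_aux (a b M m x y z p q r : ℝ) (ha : 0 ≤ a) (hb : 0 ≤ b)
    (hxy : y ≤ x) (hyz : z ≤ y) (hM : x ≤ M) (hm : m ≤ z)
    (hp : p ≤ a) (hr : -b ≤ r) (hs : p + q + r = a - b) :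
    p * x + q * y + r * z ≤ a * M - b * m := by
  have hq : q = a - b - p - r := by linarith
  subst hq
  nlinarith [mul_nonneg (sub_nonneg.2 hp) (sub_nonneg.2 hxy),
    mul_nonneg (sub_nonneg.2 hr) (sub_nonneg.2 hyz),
    mul_nonneg ha (sub_nonneg.2 hM), mul_nonneg hb (sub_nonneg.2 hm)]

/-- if `ν` is symmetric with `ω₁(ν) ≤ a`, `ω₃(ν) ≥ −b`, `trace ν = a − b`
(`a, b ≥ 0`), then `⟨ν, τ⟩ ≤ a·ω₁(τ) − b·ω₃(τ)` for every symmetric `τ`. -/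
theorem frob_le_of_eigenvalue_bounds (a b : ℝ) (ha : 0 ≤ a) (hb : 0 ≤ b)
    (ν : Mat3) (hν : ν.IsHermitian)
    (h1 : ω₁ ν ≤ a) (h3 : -b ≤ ω₃ ν) (htr : ν.trace = a - b) :
    ∀ τ : Mat3, τ.IsHermitian → frob ν τ ≤ a * ω₁ τ - b * ω₃ τ := by
  intro τ hτ
  obtain ⟨U, hU1, hU2, hU⟩ := diag_eq τ hτ
  obtain ⟨V, hV1, hV2, hV⟩ := diag_eq ν hν
  set t := hτ.eigenvalues with ht
  set l := hν.eigenvalues with hl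
  have hl1 : ∀ i, l i ≤ a := fun i => (ordEig_bounds ν hν i).2.trans h1
  have hl3 : ∀ i, -b ≤ l i := fun i => h3.trans (ordEig_bounds ν hν i).1
  have ht1 : ∀ i, t i ≤ ω₁ τ := fun i => (ordEig_bounds τ hτ i).2
  have ht3 : ∀ i, ω₃ τ ≤ t i := fun i => (ordEig_bounds τ hτ i).1
  obtain ⟨W, hW⟩ : ∃ W : Mat3, W = Uᵀ * V := ⟨_, rfl⟩
  obtain ⟨N, hN⟩ : ∃ N : Mat3, N = Uᵀ * ν * U := ⟨_, rfl⟩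
  have hWW : W * Wᵀ = 1 := by
    rw [hW, transpose_mul, transpose_transpose, Matrix.mul_assoc, ← Matrix.mul_assoc V, hV1,
      Matrix.one_mul, hU2]
  have hNW : N = W * diagonal l * Wᵀ := by
    rw [hN, hW, hV, transpose_mul, transpose_transpose]
    simp only [Matrix.mul_assoc]
  have hNtr : N.trace = a - b := by
    rw [hN, trace_mul_comm, ← Matrix.mul_assoc, hU1, Matrix.one_mul, htr]
  have hfrob : frob ν τ = ∑ i, N i i * t i := by
    have : frob ν τ = (N * diagonal t).trace := by
      unfold frob
      rw [hN]
      conv_lhs => rw [hU]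
      rw [← Matrix.mul_assoc, trace_mul_comm]
      simp only [Matrix.mul_assoc]
    rw [this]
    simp [trace, mul_diagonal]
  have hsq : ∀ i, ∑ j, W i j * W i j = 1 := by
    intro i
    have := congrFun (congrFun hWW i) i
    simpa [mul_apply] using this
  have hNi : ∀ i, N i i = ∑ j, (W i j * W i j) * l j := by
    intro i
    rw [hNW, mul_apply]
    simp only [mul_diagonal, transpose_apply]
    exact Finset.sum_congr rfl fun j _ => by ring
  have hd1 : ∀ i, N i i ≤ a := by
    intro i
    rw [hNi, ← one_mul a, ← hsq i, Finset.sum_mul]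
    exact Finset.sum_le_sum fun j _ => mul_le_mul_of_nonneg_left (hl1 j) (mul_self_nonneg _)
  have hd3 : ∀ i, -b ≤ N i i := by
    intro i
    rw [hNi, ← one_mul (-b), ← hsq i, Finset.sum_mul]
    exact Finset.sum_le_sum fun j _ => mul_le_mul_of_nonneg_left (hl3 j) (mul_self_nonneg _)
  rw [hfrob, Fin.sum_univ_three]
  rw [trace_fin_three] at hNtr
  have key : ∀ i j k : Fin 3, t j ≤ t i → t k ≤ t j → N i i + N j j + N k k = a - b →
      N i i * t i + N j j * t j + N k k * t k ≤ a * ω₁ τ - b * ω₃ τ :=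
    fun i j k hij hjk hs => scalar_aux a b _ _ _ _ _ _ _ _ ha hb hij hjk (ht1 i) (ht3 k)
      (hd1 i) (hd3 k) hs
  rcases le_total (t 0) (t 1) with h01 | h01 <;> rcases le_total (t 1) (t 2) with h12 | h12 <;>
    rcases le_total (t 0) (t 2) with h02 | h02
  · linarith [key 2 1 0 h12 h01 (by linarith)]
  · linarith [key 2 1 0 h12 h01 (by linarith)]
  · linarith [key 1 2 0 h12 h02 (by linarith)]
  · linarith [key 1 0 2 h01 h02 (by linarith)]
  · linarith [key 2 0 1 h02 h01 (by linarith)]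
  · linarith [key 0 2 1 h02 h12 (by linarith)]
  · linarith [key 0 1 2 h01 h12 (by linarith)]
  · linarith [key 0 1 2 h01 h12 (by linarith)]
end

section
/- Let a, b ≥ 0 and define g : Sym3 → ℝ by g(η) = a·ω₁(η) − b·ω₃(η). If η ∈ Sym3 and ν ∈ ∂g(η), then trace(ν) = a − b, ω₁(ν) ≤ a, and ω₃(ν) ≥ −b. -/
open Matrix

theorem ordEig_facts (A : Mat3) (h : A.IsHermitian) :
    (∀ i, ∃ j, h.eigenvalues j = ordEig A i) ∧
    (∀ j, h.eigenvalues j ≤ ω₁ A) ∧ (∀ j, ω₃ A ≤ h.eigenvalues j) := by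
  have hs : (List.insertionSort (· ≥ ·) (List.ofFn h.eigenvalues)).Pairwise (· ≥ ·) :=
    List.pairwise_insertionSort _ _
  have hl : (List.insertionSort (· ≥ ·) (List.ofFn h.eigenvalues)).length = 3 := by
    rw [List.length_insertionSort, List.length_ofFn]
  have hm : ∀ x, x ∈ List.insertionSort (· ≥ ·) (List.ofFn h.eigenvalues) ↔
      ∃ j, h.eigenvalues j = x := by
    intro x
    rw [List.mem_insertionSort, List.mem_ofFn']
    simp
  have ho : ∀ i, ordEig A i =
      (List.insertionSort (· ≥ ·) (List.ofFn h.eigenvalues)).getD i.1 0 := by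
    intro i
    simp only [ordEig, dif_pos h]
  simp only [ω₁, ω₃, ho]
  generalize List.insertionSort (· ≥ ·) (List.ofFn h.eigenvalues) = l at hs hl hm
  obtain ⟨x, y, z, rfl⟩ := List.length_eq_three.mp hl
  simp only [List.pairwise_cons, List.mem_cons, List.not_mem_nil] at hs hm
  refine ⟨?_, ?_, ?_⟩
  · intro i
    rw [← hm]
    fin_cases i <;> simp
  · intro j
    have := (hm (h.eigenvalues j)).2 ⟨j, rfl⟩
    simp
    grind
  · intro j
    have := (hm (h.eigenvalues j)).2 ⟨j, rfl⟩
    simp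
    grind

theorem eigvec (A : Mat3) (h : A.IsHermitian) (j : Fin 3) :
    ∃ v : Fin 3 → ℝ, v ⬝ᵥ v = 1 ∧ A *ᵥ v = h.eigenvalues j • v := by
  refine ⟨(h.eigenvectorBasis j).ofLp, ?_, h.mulVec_eigenvectorBasis j⟩
  have h1 := h.eigenvectorBasis.orthonormal.1 j
  have h2 := real_inner_self_eq_norm_sq (h.eigenvectorBasis j)
  rw [h1, EuclideanSpace.inner_eq_star_dotProduct] at h2
  simpa using h2

theorem ordEig_vec (A : Mat3) (h : A.IsHermitian) (i : Fin 3) :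
    ∃ v : Fin 3 → ℝ, v ⬝ᵥ v = 1 ∧ A *ᵥ v = ordEig A i • v := by
  obtain ⟨j, hj⟩ := (ordEig_facts A h).1 i
  rw [← hj]
  exact eigvec A h j

theorem eig_of_vec (A : Mat3) (h : A.IsHermitian) (v : Fin 3 → ℝ) (m : ℝ)
    (hv : v ⬝ᵥ v = 1) (hA : A *ᵥ v = m • v) : ∃ j, h.eigenvalues j = m := by
  have : m ∈ spectrum ℝ A := by
    rw [← Matrix.spectrum_toLin']
    apply Module.End.HasEigenvalue.mem_spectrum
    apply Module.End.hasEigenvalue_of_hasEigenvector (x := v)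
    refine ⟨Module.End.mem_eigenspace_iff.2 (by simpa using hA), ?_⟩
    rintro rfl
    simp at hv
  rw [h.spectrum_real_eq_range_eigenvalues] at this
  exact this

theorem quad_le (A : Mat3) (h : A.IsHermitian) (x : Fin 3 → ℝ) :
    x ⬝ᵥ (A *ᵥ x) ≤ ω₁ A * (x ⬝ᵥ x) := by
  have hB : (ω₁ A • (1 : Mat3) - A).IsHermitian :=
    (Matrix.isHermitian_one.smul (IsSelfAdjoint.all _)).sub h
  have hp : (ω₁ A • (1 : Mat3) - A).PosSemidef := by
    rw [hB.posSemidef_iff_eigenvalues_nonneg]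
    intro j
    obtain ⟨v, hv, hm⟩ := eigvec _ hB j
    obtain ⟨k, hk⟩ := eig_of_vec A h v (ω₁ A - hB.eigenvalues j) hv (by
      rw [sub_smul, ← hm]; simp [Matrix.sub_mulVec, Matrix.smul_mulVec])
    have := (ordEig_facts A h).2.1 k
    simp
    linarith
  have := hp.dotProduct_mulVec_nonneg x
  simp [Matrix.sub_mulVec, Matrix.smul_mulVec, dotProduct_sub] at this
  linarith

theorem le_quad (A : Mat3) (h : A.IsHermitian) (x : Fin 3 → ℝ) :
    ω₃ A * (x ⬝ᵥ x) ≤ x ⬝ᵥ (A *ᵥ x) := by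
  have hB : (A - ω₃ A • (1 : Mat3)).IsHermitian :=
    h.sub (Matrix.isHermitian_one.smul (IsSelfAdjoint.all _))
  have hp : (A - ω₃ A • (1 : Mat3)).PosSemidef := by
    rw [hB.posSemidef_iff_eigenvalues_nonneg]
    intro j
    obtain ⟨v, hv, hm⟩ := eigvec _ hB j
    obtain ⟨k, hk⟩ := eig_of_vec A h v (ω₃ A + hB.eigenvalues j) hv (by
      rw [add_smul, ← hm]; simp [Matrix.sub_mulVec, Matrix.smul_mulVec])
    have := (ordEig_facts A h).2.2 k
    simp
    linarith
  have := hp.dotProduct_mulVec_nonneg x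
  simp [Matrix.sub_mulVec, Matrix.smul_mulVec, dotProduct_sub] at this
  linarith

/-- Master estimate: a perturbation `P` with quadratic form between `m` and `M`. -/
theorem key (a b : ℝ) (ha : 0 ≤ a) (hb : 0 ≤ b) (η ν : Mat3) (hη : η.IsHermitian)
    (hmem : ν ∈ subdiff (fun τ : Mat3 => a * ω₁ τ - b * ω₃ τ) η)
    (P : Mat3) (hP : P.IsHermitian) (m M : ℝ)
    (hm : ∀ x : Fin 3 → ℝ, x ⬝ᵥ x = 1 → m ≤ x ⬝ᵥ (P *ᵥ x))
    (hM : ∀ x : Fin 3 → ℝ, x ⬝ᵥ x = 1 → x ⬝ᵥ (P *ᵥ x) ≤ M) :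
    (ν * P).trace ≤ a * M - b * m := by
  have hh : (η + P).IsHermitian := hη.add hP
  have h := hmem.2 (η + P) hh
  simp only [frob, add_sub_cancel_left] at h
  have h1 : ω₁ (η + P) ≤ ω₁ η + M := by
    obtain ⟨v, hv, he⟩ := ordEig_vec _ hh 0
    have e : v ⬝ᵥ ((η + P) *ᵥ v) = ω₁ (η + P) := by
      rw [he, dotProduct_smul, hv]; simp [ω₁]
    rw [Matrix.add_mulVec, dotProduct_add] at e
    have := quad_le η hη v
    have := hM v hv
    rw [hv] at *
    linarith
  have h3 : ω₃ η + m ≤ ω₃ (η + P) := by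
    obtain ⟨v, hv, he⟩ := ordEig_vec _ hh 2
    have e : v ⬝ᵥ ((η + P) *ᵥ v) = ω₃ (η + P) := by
      rw [he, dotProduct_smul, hv]; simp [ω₃]
    rw [Matrix.add_mulVec, dotProduct_add] at e
    have := le_quad η hη v
    have := hm v hv
    rw [hv] at *
    linarith
  nlinarith [mul_le_mul_of_nonneg_left h1 ha, mul_le_mul_of_nonneg_left h3 hb]

theorem quad_rankOne (v x : Fin 3 → ℝ) :
    x ⬝ᵥ (vecMulVec v v *ᵥ x) = (v ⬝ᵥ x) ^ 2 := by
  simp [dotProduct, mulVec, vecMulVec_apply, Fin.sum_univ_three]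
  ring

theorem rankOne_le (v x : Fin 3 → ℝ) (hv : v ⬝ᵥ v = 1) (hx : x ⬝ᵥ x = 1) :
    (v ⬝ᵥ x) ^ 2 ≤ 1 := by
  have := Finset.sum_mul_sq_le_sq_mul_sq Finset.univ v x
  simp only [dotProduct, ← pow_two] at *
  rw [hv, hx] at this
  linarith

theorem trace_rankOne (A : Mat3) (v : Fin 3 → ℝ) (c : ℝ) (hv : v ⬝ᵥ v = 1)
    (h : A *ᵥ v = c • v) : (A * vecMulVec v v).trace = c := by
  rw [Matrix.mul_vecMulVec, h, Matrix.trace_vecMulVec, smul_dotProduct, hv]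
  simp

theorem herm_rankOne (v : Fin 3 → ℝ) : (vecMulVec v v).IsHermitian := by
  ext i j
  simp [vecMulVec_apply, mul_comm]

/-- if `g(η) = a·ω₁(η) − b·ω₃(η)` with `a, b ≥ 0` and `ν ∈ ∂g(η)`, then
`trace ν = a − b`, `ω₁(ν) ≤ a` and `ω₃(ν) ≥ −b`. -/
theorem subdiff_eigenvalue_bounds (a b : ℝ) (ha : 0 ≤ a) (hb : 0 ≤ b)
    (η ν : Mat3) (hη : η.IsHermitian)
    (hmem : ν ∈ subdiff (fun τ : Mat3 => a * ω₁ τ - b * ω₃ τ) η) :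
    ν.trace = a - b ∧ ω₁ ν ≤ a ∧ -b ≤ ω₃ ν := by
  refine ⟨le_antisymm ?_ ?_, ?_, ?_⟩
  · have := key a b ha hb η ν hη hmem 1 Matrix.isHermitian_one 1 1
      (by intro x hx; simp [hx]) (by intro x hx; simp [hx])
    simpa using this
  · have := key a b ha hb η ν hη hmem (-1) Matrix.isHermitian_one.neg (-1) (-1)
      (by intro x hx; simp [Matrix.neg_mulVec, hx]) (by intro x hx; simp [Matrix.neg_mulVec, hx])
    simp at this
    linarith
  · obtain ⟨v, hv, he⟩ := ordEig_vec ν hmem.1 0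
    have := key a b ha hb η ν hη hmem (vecMulVec v v) (herm_rankOne v) 0 1
      (by intro x hx; rw [quad_rankOne]; positivity)
      (by intro x hx; rw [quad_rankOne]; exact rankOne_le v x hv hx)
    rw [trace_rankOne ν v _ hv he] at this
    simpa [ω₁] using this
  · obtain ⟨v, hv, he⟩ := ordEig_vec ν hmem.1 2
    have := key a b ha hb η ν hη hmem (-vecMulVec v v) (herm_rankOne v).neg (-1) 0
      (by
        intro x hx
        rw [Matrix.neg_mulVec, dotProduct_neg, quad_rankOne]
        linarith [rankOne_le v x hv hx])
      (by
        intro x hx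
        rw [Matrix.neg_mulVec, dotProduct_neg, quad_rankOne]
        linarith [sq_nonneg (v ⬝ᵥ x)])
    rw [Matrix.mul_neg, Matrix.trace_neg, trace_rankOne ν v _ hv he] at this
    simp only [ω₃]
    linarith
end

section
/- Let a, b ≥ 0 and define g : Sym3 → ℝ by g(η) = a·ω₁(η) − b·ω₃(η). Then for every η ∈ Sym3 and ν ∈ Sym3, ν ∈ ∂g(η) if and only if there exist a triple (e₁, e₂, e₃) ∈ V(η) and real numbers ν₁, ν₂, ν₃ such that ν = ν₁·e₁e₁ᵀ + ν₂·e₂e₂ᵀ + ν₃·e₃e₃ᵀ, a ≥ ν₁ ≥ ν₂ ≥ ν₃ ≥ −b, ν₁ + ν₂ + ν₃ = a − b, (ν₁ − a)·(ω₁(η) − ω₂(η)) = 0, and (ν₃ + b)·(ω₂(η) − ω₃(η)) = 0. -/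
open Matrix

theorem ordEig_eq {A : Mat3} (h : A.IsHermitian) : ∃ σ : Equiv.Perm (Fin 3),
    (∀ i, ordEig A i = h.eigenvalues (σ i)) ∧ Antitone (ordEig A) := by
  classical
  set f := h.eigenvalues with hf
  let σ : Equiv.Perm (Fin 3) := Tuple.sort (fun i => -f i)
  have hm : Antitone (f ∘ σ) := by
    intro i j hij
    have := Tuple.monotone_sort (fun i => -f i) hij
    simp only [Function.comp] at this ⊢
    exact neg_le_neg_iff.mp this
  have hp : (List.ofFn (f ∘ σ)).Perm (List.ofFn f) := Equiv.Perm.ofFn_comp_perm σ f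
  have hs : (List.ofFn (f ∘ σ)).Pairwise (· ≥ ·) := by
    rw [List.pairwise_ofFn]
    intro i j hij
    exact hm hij.le
  have he : List.insertionSort (· ≥ ·) (List.ofFn f) = List.ofFn (f ∘ σ) := by
    refine List.Perm.eq_of_pairwise' (r := (· ≥ ·)) ?_ hs ((List.perm_insertionSort _ _).trans hp.symm)
    exact List.pairwise_insertionSort _ _
  have key : ∀ i, ordEig A i = f (σ i) := by
    intro i
    rw [ordEig, dif_pos h, ← hf, he]
    rw [List.getD_eq_getElem _ _ (by simp)]
    exact List.getElem_ofFn _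
  refine ⟨σ, key, ?_⟩
  intro i j hij
  rw [key, key]
  exact hm hij

def ON3 (f : Fin 3 → (Fin 3 → ℝ)) : Prop := ∀ i j, f i ⬝ᵥ f j = if i = j then (1 : ℝ) else 0

noncomputable def DD (f : Fin 3 → (Fin 3 → ℝ)) (c : Fin 3 → ℝ) : Mat3 :=
  ∑ i, c i • vecMulVec (f i) (f i)

theorem spec {A : Mat3} (h : A.IsHermitian) : ∃ f, ON3 f ∧
    ∀ i, A.mulVec (f i) = ordEig A i • f i := by
  obtain ⟨σ, hσ, -⟩ := ordEig_eq h
  refine ⟨fun i => (h.eigenvectorBasis (σ i)).ofLp, ?_, ?_⟩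
  · intro i j
    have := (orthonormal_iff_ite.mp h.eigenvectorBasis.orthonormal) (σ j) (σ i)
    rw [EuclideanSpace.inner_eq_star_dotProduct] at this
    simpa [eq_comm] using this
  · intro i
    rw [hσ]
    exact h.mulVec_eigenvectorBasis (σ i)

theorem expand {f : Fin 3 → (Fin 3 → ℝ)} (hf : ON3 f) (x : Fin 3 → ℝ) :
    x = ∑ i, (f i ⬝ᵥ x) • f i := by
  let U : Mat3 := Matrix.of f
  have h1 : U * Uᵀ = 1 := by
    ext i j
    rw [Matrix.mul_apply', Matrix.one_apply]
    exact hf i j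
  have h2 : Uᵀ * U = 1 := mul_eq_one_comm.mp h1
  have : Uᵀ *ᵥ (U *ᵥ x) = x := by rw [Matrix.mulVec_mulVec, h2, Matrix.one_mulVec]
  conv_lhs => rw [← this]
  ext k
  simp only [Matrix.mulVec, dotProduct, U, Matrix.transpose_apply, Matrix.of_apply,
    Finset.sum_apply, Pi.smul_apply, smul_eq_mul]
  exact Finset.sum_congr rfl fun i _ => mul_comm _ _

theorem DD_mulVec (f : Fin 3 → (Fin 3 → ℝ)) (c x) :
    DD f c *ᵥ x = ∑ i, (c i * (f i ⬝ᵥ x)) • f i := by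
  ext k
  simp [DD, Matrix.mulVec, dotProduct, Fin.sum_univ_three, vecMulVec_apply]
  ring

theorem eq_DD {f : Fin 3 → (Fin 3 → ℝ)} (hf : ON3 f) {A : Mat3} {c : Fin 3 → ℝ}
    (h : ∀ i, A *ᵥ f i = c i • f i) : A = DD f c := by
  apply Matrix.mulVec_injective
  funext x
  rw [DD_mulVec]
  conv_lhs => rw [expand hf x]
  rw [Matrix.mulVec_sum]
  refine Finset.sum_congr rfl fun i _ => ?_
  rw [Matrix.mulVec_smul, h, smul_smul, mul_comm]

theorem DD_eig {f : Fin 3 → (Fin 3 → ℝ)} (hf : ON3 f) (c : Fin 3 → ℝ) (i) :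
    DD f c *ᵥ f i = c i • f i := by
  rw [DD_mulVec]
  simp [hf _ i]

theorem DD_herm (f c) : (DD f c).IsHermitian := by
  ext i j
  simp [DD, Fin.sum_univ_three, vecMulVec_apply]
  ring

theorem frob_DD (f c) (B : Mat3) : frob (DD f c) B = ∑ i, c i * (f i ⬝ᵥ B *ᵥ f i) := by
  simp [frob, DD, Matrix.trace, Matrix.mul_apply, Matrix.mulVec, dotProduct, Fin.sum_univ_three,
    vecMulVec_apply]
  ring

theorem quad_DD (f c) (x : Fin 3 → ℝ) : x ⬝ᵥ DD f c *ᵥ x = ∑ i, c i * (f i ⬝ᵥ x) ^ 2 := by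
  rw [DD_mulVec, dotProduct_sum]
  refine Finset.sum_congr rfl fun i _ => ?_
  rw [dotProduct_smul, dotProduct_comm x, smul_eq_mul]; ring

theorem parseval {f : Fin 3 → (Fin 3 → ℝ)} (hf : ON3 f) (x : Fin 3 → ℝ) :
    x ⬝ᵥ x = ∑ i, (f i ⬝ᵥ x) ^ 2 := by
  conv_lhs => rw [expand hf x]
  rw [sum_dotProduct]
  refine Finset.sum_congr rfl fun i _ => ?_
  rw [smul_dotProduct, ← expand hf x, smul_eq_mul]; ring

theorem trace_q {f : Fin 3 → (Fin 3 → ℝ)} (hf : ON3 f) (B : Mat3) :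
    ∑ i, f i ⬝ᵥ B *ᵥ f i = B.trace := by
  have h1 : (1 : Mat3) = DD f (fun _ => 1) := eq_DD hf (by simp)
  have := frob_DD f (fun _ => 1) B
  rw [← h1] at this
  simpa [frob] using this.symm

theorem anti3 {c : Fin 3 → ℝ} (h : Antitone c) : c 1 ≤ c 0 ∧ c 2 ≤ c 1 :=
  ⟨h (by decide), h (by decide)⟩

/-- Rayleigh bounds for unit vectors -/
theorem ray {f : Fin 3 → (Fin 3 → ℝ)} (hf : ON3 f) {c : Fin 3 → ℝ} (hc : Antitone c)
    {x : Fin 3 → ℝ} (hx : x ⬝ᵥ x = 1) :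
    x ⬝ᵥ DD f c *ᵥ x ≤ c 0 ∧ c 2 ≤ x ⬝ᵥ DD f c *ᵥ x := by
  rw [quad_DD]
  rw [parseval hf] at hx
  obtain ⟨h1, h2⟩ := anti3 hc
  simp only [Fin.sum_univ_three] at *
  generalize f 0 ⬝ᵥ x = p at *
  generalize f 1 ⬝ᵥ x = q at *
  generalize f 2 ⬝ᵥ x = r at *
  have hp : p ^ 2 = 1 - q ^ 2 - r ^ 2 := by linarith
  constructor
  · rw [hp]
    nlinarith [mul_nonneg (sub_nonneg.2 h1) (sq_nonneg q), mul_nonneg (sub_nonneg.2 h1) (sq_nonneg r),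
      mul_nonneg (sub_nonneg.2 h2) (sq_nonneg r)]
  · have hr : r ^ 2 = 1 - p ^ 2 - q ^ 2 := by linarith
    rw [hr]
    nlinarith [mul_nonneg (sub_nonneg.2 h1) (sq_nonneg p), mul_nonneg (sub_nonneg.2 h2) (sq_nonneg p),
      mul_nonneg (sub_nonneg.2 h2) (sq_nonneg q)]

theorem ray_eq {f : Fin 3 → (Fin 3 → ℝ)} (hf : ON3 f) {c : Fin 3 → ℝ}
    {x : Fin 3 → ℝ} {m : ℝ} (h : ∀ i, (m - c i) * (f i ⬝ᵥ x) ^ 2 = 0) :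
    DD f c *ᵥ x = m • x := by
  rw [DD_mulVec]
  conv_rhs => rw [expand hf x]
  rw [Finset.smul_sum]
  refine Finset.sum_congr rfl fun i _ => ?_
  rw [smul_smul]
  congr 1
  rcases mul_eq_zero.mp (h i) with h | h
  · rw [sub_eq_zero.mp h]
  · rw [pow_eq_zero_iff (by norm_num)] at h
    rw [h]; simp

theorem ray_top {f : Fin 3 → (Fin 3 → ℝ)} (hf : ON3 f) {c : Fin 3 → ℝ} (hc : Antitone c)
    {x : Fin 3 → ℝ} (hx : x ⬝ᵥ x = 1) (h : c 0 ≤ x ⬝ᵥ DD f c *ᵥ x) :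
    DD f c *ᵥ x = c 0 • x := by
  apply ray_eq hf
  have hn : ∀ i, 0 ≤ (c 0 - c i) * (f i ⬝ᵥ x) ^ 2 := fun i =>
    mul_nonneg (sub_nonneg.2 (hc (Fin.zero_le i))) (sq_nonneg _)
  have hs : ∑ i, (c 0 - c i) * (f i ⬝ᵥ x) ^ 2 ≤ 0 := by
    simp only [sub_mul, Finset.sum_sub_distrib, ← Finset.mul_sum, ← parseval hf, hx]
    rw [quad_DD] at h
    linarith
  have := (Finset.sum_eq_zero_iff_of_nonneg (fun i _ => hn i)).mp
    (le_antisymm hs (Finset.sum_nonneg fun i _ => hn i))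
  exact fun i => this i (Finset.mem_univ i)

theorem ray_bot {f : Fin 3 → (Fin 3 → ℝ)} (hf : ON3 f) {c : Fin 3 → ℝ} (hc : Antitone c)
    {x : Fin 3 → ℝ} (hx : x ⬝ᵥ x = 1) (h : x ⬝ᵥ DD f c *ᵥ x ≤ c 2) :
    DD f c *ᵥ x = c 2 • x := by
  apply ray_eq hf
  have hn : ∀ i, (c 2 - c i) * (f i ⬝ᵥ x) ^ 2 ≤ 0 := fun i =>
    mul_nonpos_of_nonpos_of_nonneg (sub_nonpos.2 (hc (Fin.le_last i))) (sq_nonneg _)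
  have hs : 0 ≤ ∑ i, (c 2 - c i) * (f i ⬝ᵥ x) ^ 2 := by
    simp only [sub_mul, Finset.sum_sub_distrib, ← Finset.mul_sum, ← parseval hf, hx]
    rw [quad_DD] at h
    linarith
  have := (Finset.sum_eq_zero_iff_of_nonpos (fun i _ => hn i)).mp
    (le_antisymm (Finset.sum_nonpos fun i _ => hn i) hs)
  exact fun i => this i (Finset.mem_univ i)

theorem quad_eig {A : Mat3} {x : Fin 3 → ℝ} {m : ℝ} (hx : x ⬝ᵥ x = 1) (h : A *ᵥ x = m • x) :
    x ⬝ᵥ A *ᵥ x = m := by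
  rw [h, dotProduct_smul, hx]; simp

theorem ON3.one {f : Fin 3 → (Fin 3 → ℝ)} (hf : ON3 f) (i) : f i ⬝ᵥ f i = 1 := by
  simpa using hf i i

theorem ext_eig {f : Fin 3 → (Fin 3 → ℝ)} (hf : ON3 f) {c : Fin 3 → ℝ} (hc : Antitone c) :
    ω₁ (DD f c) = c 0 ∧ ω₃ (DD f c) = c 2 := by
  obtain ⟨e, he, hA⟩ := spec (DD_herm f c)
  obtain ⟨_, _, ho⟩ := ordEig_eq (DD_herm f c)
  have hE := eq_DD he hA
  have a0 := ray hf hc (he.one 0)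
  have a2 := ray hf hc (he.one 2)
  rw [quad_eig (he.one _) (hA _)] at a0 a2
  have b0 := ray he ho (hf.one 0)
  have b2 := ray he ho (hf.one 2)
  rw [← hE, quad_eig (hf.one _) (DD_eig hf c _)] at b0 b2
  exact ⟨le_antisymm a0.1 b0.1, le_antisymm b2.2 a2.2⟩

theorem fan {f e : Fin 3 → (Fin 3 → ℝ)} (hf : ON3 f) (he : ON3 e) {α β : Fin 3 → ℝ}
    (hα : Antitone α) (hβ : Antitone β) :
    frob (DD f α) (DD e β) ≤ ∑ i, α i * β i := by
  rw [frob_DD]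
  have h0 := (ray he hβ (hf.one 0)).1
  have h2 := (ray he hβ (hf.one 2)).2
  have t := trace_q hf (DD e β)
  have t' := trace_q he (DD e β)
  rw [← t'] at t
  simp only [quad_eig (he.one _) (DD_eig he β _)] at t
  obtain ⟨h1, h1'⟩ := anti3 hα
  simp only [Fin.sum_univ_three] at *
  generalize f 0 ⬝ᵥ DD e β *ᵥ f 0 = p at *
  generalize f 1 ⬝ᵥ DD e β *ᵥ f 1 = q at *
  generalize f 2 ⬝ᵥ DD e β *ᵥ f 2 = r at *
  have : q = β 0 + β 1 + β 2 - p - r := by linarith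
  subst this
  nlinarith [mul_nonneg (sub_nonneg.2 h1) (sub_nonneg.2 h0),
    mul_nonneg (sub_nonneg.2 h1') (sub_nonneg.2 h2)]

theorem frob_self {f c} (hf : ON3 f) : frob (DD f c) (DD f c) = ∑ i, c i * c i := by
  rw [frob_DD]
  simp only [quad_eig (hf.one _) (DD_eig hf c _)]

theorem mid {h : Fin 3 → (Fin 3 → ℝ)} (hh : ON3 h) {e} (he : ON3 e) {c : Fin 3 → ℝ}
    (h0 : DD e c *ᵥ h 0 = c 0 • h 0) (h2 : DD e c *ᵥ h 2 = c 2 • h 2) :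
    ∀ i, DD e c *ᵥ h i = c i • h i := by
  have sym : ∀ x y : Fin 3 → ℝ, x ⬝ᵥ DD e c *ᵥ y = y ⬝ᵥ DD e c *ᵥ x := by
    intro x y
    rw [dotProduct_mulVec, ← mulVec_transpose, dotProduct_comm]
    have := DD_herm e c
    rw [IsHermitian, conjTranspose_eq_transpose_of_trivial] at this
    rw [this]
  have t := trace_q hh (DD e c)
  have t' := trace_q he (DD e c)
  rw [← t'] at t
  simp only [quad_eig (he.one _) (DD_eig he c _)] at t
  simp only [Fin.sum_univ_three] at t
  rw [quad_eig (hh.one _) h0, quad_eig (hh.one _) h2] at t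
  have h1 : DD e c *ᵥ h 1 = c 1 • h 1 := by
    rw [expand hh (DD e c *ᵥ h 1)]
    rw [Fin.sum_univ_three, sym (h 0), sym (h 2), h0, h2]
    have : h 1 ⬝ᵥ DD e c *ᵥ h 1 = c 1 := by linarith
    rw [this, dotProduct_smul, dotProduct_smul, hh, hh]
    simp
  intro i
  fin_cases i
  · exact h0
  · exact h1
  · exact h2

theorem simul {A B : Mat3} (hA : A.IsHermitian) (hB : B.IsHermitian)
    (hF : ∑ i, ordEig A i * ordEig B i ≤ frob A B) :
    ∃ h, ON3 h ∧ (∀ i, A *ᵥ h i = ordEig A i • h i) ∧ (∀ i, B *ᵥ h i = ordEig B i • h i) := by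
  obtain ⟨f, hf, hfA⟩ := spec hA
  obtain ⟨e, he, heB⟩ := spec hB
  obtain ⟨h, hh, hS⟩ := spec (hA.add hB)
  obtain ⟨_, _, oA⟩ := ordEig_eq hA
  obtain ⟨_, _, oB⟩ := ordEig_eq hB
  obtain ⟨_, _, oS⟩ := ordEig_eq (hA.add hB)
  have dA := eq_DD hf hfA
  have dB := eq_DD he heB
  have dS := eq_DD hh hS
  have f1 := fan hh hf oS oA
  have f2 := fan hh he oS oB
  have f3 := frob_self (c := ordEig (A + B)) hh
  have f4 := frob_self (c := ordEig A) hf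
  have f5 := frob_self (c := ordEig B) he
  rw [← dA] at f1 f4
  rw [← dB] at f2 f5
  rw [← dS] at f1 f2 f3
  have cm : frob B A = frob A B := by rw [frob, frob, trace_mul_comm]
  have g1 : frob (A + B) A = frob A A + frob A B := by
    rw [← cm]; simp [frob, add_mul]
  have g2 : frob (A + B) B = frob A B + frob B B := by
    simp [frob, add_mul]
  have g3 : frob (A + B) (A + B) = frob (A + B) A + frob (A + B) B := by
    simp [frob, mul_add]
  have key : ∀ i, ordEig (A + B) i = ordEig A i + ordEig B i := by
    have : ∑ i, (ordEig (A + B) i - ordEig A i - ordEig B i) ^ 2 ≤ 0 := by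
      simp only [Fin.sum_univ_three] at *
      nlinarith
    have := (Finset.sum_eq_zero_iff_of_nonneg (fun i _ => sq_nonneg _)).mp
      (le_antisymm this (Finset.sum_nonneg fun i _ => sq_nonneg _))
    intro i
    have := this i (Finset.mem_univ i)
    rw [pow_eq_zero_iff (by norm_num)] at this
    linarith
  have q : ∀ i, h i ⬝ᵥ A *ᵥ h i + h i ⬝ᵥ B *ᵥ h i = ordEig A i + ordEig B i := by
    intro i
    rw [← dotProduct_add, ← add_mulVec, quad_eig (hh.one i) (hS i), key]
  have rA := fun i => ray hf oA (hh.one i)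
  have rB := fun i => ray he oB (hh.one i)
  have tA := fun i => ray_top hf oA (hh.one i)
  have tB := fun i => ray_top he oB (hh.one i)
  have bA := fun i => ray_bot hf oA (hh.one i)
  have bB := fun i => ray_bot he oB (hh.one i)
  have mA := mid hh hf (c := ordEig A)
  have mB := mid hh he (c := ordEig B)
  rw [← dA] at rA tA bA mA
  rw [← dB] at rB tB bB mB
  refine ⟨h, hh, mA (tA 0 ?_) (bA 2 ?_), mB (tB 0 ?_) (bB 2 ?_)⟩
  · linarith [q 0, rB 0]
  · linarith [q 2, (rB 2).2]
  · linarith [q 0, rA 0]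
  · linarith [q 2, (rA 2).2]

theorem frob_sub (A B C : Mat3) : frob A (B - C) = frob A B - frob A C := by
  simp [frob, mul_sub]

theorem bound_aux {a b M m q0 q1 q2 x y z : ℝ} (ha : 0 ≤ a) (hb : 0 ≤ b)
    (h0 : q0 ≤ M ∧ m ≤ q0) (h1 : q1 ≤ M ∧ m ≤ q1) (h2 : q2 ≤ M ∧ m ≤ q2)
    (xa : x ≤ a) (yx : y ≤ x) (zy : z ≤ y) (bz : -b ≤ z) (s : x + y + z = a - b) :
    x * q0 + y * q1 + z * q2 ≤ a * M - b * m := by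
  obtain ⟨h0, h0'⟩ := h0
  obtain ⟨h1, h1'⟩ := h1
  obtain ⟨h2, h2'⟩ := h2
  have hM : m ≤ M := h0'.trans h0
  have up : ∀ {t q : ℝ}, q ≤ M → 0 ≤ t → t * q ≤ t * M := fun h ht => mul_le_mul_of_nonneg_left h ht
  have dn : ∀ {t q : ℝ}, m ≤ q → t ≤ 0 → t * q ≤ t * m := fun h ht => mul_le_mul_of_nonpos_left h ht
  have B1 := mul_nonneg hb (sub_nonneg.2 hM)
  have A1 := mul_nonneg ha (sub_nonneg.2 hM)
  have Z1 := mul_nonneg (by linarith : 0 ≤ z + b) (sub_nonneg.2 hM)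
  have X1 := mul_nonneg (sub_nonneg.2 xa) (sub_nonneg.2 hM)
  rcases le_total 0 y with hy | hy
  · have e0 := up h0 (hy.trans yx)
    have e1 := up h1 hy
    have : x = a - b - y - z := by linarith
    rcases le_total 0 z with hz | hz
    · have e2 := up h2 hz
      subst this; nlinarith
    · have e2 := dn h2' hz
      subst this; nlinarith
  · have e1 := dn h1' hy
    have e2 := dn h2' (zy.trans hy)
    have : z = a - b - x - y := by linarith
    rcases le_total 0 x with hx | hx
    · have e0 := up h0 hx
      subst this; nlinarith
    · have e0 := dn h0' hx
      subst this; nlinarith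

/-- Lemma 2.1 of the paper: full characterization of the subdifferential of
`g(η) = a·ω₁(η) − b·ω₃(η)` (`a, b ≥ 0`) at a symmetric matrix `η`. -/
theorem subdiff_characterization (a b : ℝ) (ha : 0 ≤ a) (hb : 0 ≤ b)
    (η ν : Mat3) (hη : η.IsHermitian) :
    ν ∈ subdiff (fun τ : Mat3 => a * ω₁ τ - b * ω₃ τ) η ↔
      ∃ e ∈ Vset η, ∃ ν₁ ν₂ ν₃ : ℝ,
        ν = ν₁ • vecMulVec (e 0) (e 0) + ν₂ • vecMulVec (e 1) (e 1) +
            ν₃ • vecMulVec (e 2) (e 2) ∧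
        ν₁ ≤ a ∧ ν₂ ≤ ν₁ ∧ ν₃ ≤ ν₂ ∧ -b ≤ ν₃ ∧
        ν₁ + ν₂ + ν₃ = a - b ∧
        (ν₁ - a) * (ω₁ η - ω₂ η) = 0 ∧
        (ν₃ + b) * (ω₂ η - ω₃ η) = 0 := by
  have oη := (ordEig_eq hη).choose_spec.2
  constructor
  · rintro ⟨hν, hsub⟩
    have oν := (ordEig_eq hν).choose_spec.2
    simp only [frob_sub] at hsub
    obtain ⟨f, hf, hfν⟩ := spec hν
    have dν := eq_DD hf hfν
    have hF : ∑ i, ordEig ν i * ordEig η i ≤ frob ν η := by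
      have h1 := hsub (DD f (ordEig η)) (DD_herm _ _)
      obtain ⟨x1, x3⟩ := ext_eig hf oη
      rw [x1, x3] at h1
      have h2 : frob ν (DD f (ordEig η)) = ∑ i, ordEig ν i * ordEig η i := by
        conv_lhs => rw [dν]
        rw [frob_DD]
        simp only [quad_eig (hf.one _) (DD_eig hf _ _)]
      rw [h2] at h1
      simp only [ω₁, ω₃] at h1
      linarith
    obtain ⟨e, he, heν, heη⟩ := simul hν hη hF
    have dν' := eq_DD he heν
    have dη' := eq_DD he heη
    have test : ∀ c : Fin 3 → ℝ, Antitone c →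
        a * ω₁ η - b * ω₃ η + ∑ i, ordEig ν i * (c i - ordEig η i) ≤ a * c 0 - b * c 2 := by
      intro c hc
      have h1 := hsub (DD e c) (DD_herm _ _)
      obtain ⟨x1, x3⟩ := ext_eig he hc
      rw [x1, x3] at h1
      have h2 : ∀ d, frob ν (DD e d) = ∑ i, ordEig ν i * d i := by
        intro d
        conv_lhs => rw [dν']
        rw [frob_DD]
        simp only [quad_eig (he.one _) (DD_eig he _ _)]
      have h3 := h2 (ordEig η)
      rw [← dη'] at h3
      rw [h2, h3] at h1
      simpa only [mul_sub, Finset.sum_sub_distrib] using h1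
    have test' : ∀ x y z : ℝ, y ≤ x → z ≤ y → 
        a * ω₁ η - b * ω₃ η + (ordEig ν 0 * (x - ω₁ η) + ordEig ν 1 * (y - ω₂ η)
          + ordEig ν 2 * (z - ω₃ η)) ≤ a * x - b * z := by
      intro x y z h1 h2
      have hc : Antitone ![x, y, z] := by
        intro i j hij
        fin_cases i <;> fin_cases j <;> simp at hij ⊢ <;> linarith
      simpa [Fin.sum_univ_three, ω₁, ω₂, ω₃] using test _ hc
    obtain ⟨n1, n2⟩ := anti3 oν
    have w1 : ω₂ η ≤ ω₁ η := (anti3 oη).1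
    have w2 : ω₃ η ≤ ω₂ η := (anti3 oη).2
    have c1 : ordEig ν 0 ≤ a := by
      have := test' (ω₁ η + 1) (ω₂ η) (ω₃ η) (by linarith) w2
      linarith
    have c3 : -b ≤ ordEig ν 2 := by
      have := test' (ω₁ η) (ω₂ η) (ω₃ η - 1) w1 (by linarith)
      linarith
    refine ⟨e, ⟨he, heη⟩, ordEig ν 0, ordEig ν 1, ordEig ν 2, ?_, c1, n1, n2, c3, ?_, ?_, ?_⟩
    · conv_lhs => rw [dν']
      rw [DD, Fin.sum_univ_three]
    · have u := test' (ω₁ η + 1) (ω₂ η + 1) (ω₃ η + 1) (by linarith) (by linarith)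
      have v := test' (ω₁ η - 1) (ω₂ η - 1) (ω₃ η - 1) (by linarith) (by linarith)
      linarith
    · have u := test' (ω₂ η) (ω₂ η) (ω₃ η) le_rfl w2
      have v := mul_nonneg (sub_nonneg.2 c1) (sub_nonneg.2 w1)
      linarith
    · have u := test' (ω₁ η) (ω₂ η) (ω₂ η) w1 le_rfl
      have v := mul_nonneg (by linarith : 0 ≤ ordEig ν 2 + b) (sub_nonneg.2 w2)
      linarith
  · rintro ⟨e, ⟨he, heη⟩, x, y, z, hν, xa, yx, zy, bz, s, k1, k3⟩
    have he : ON3 e := he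
    have dν : ν = DD e ![x, y, z] := by
      rw [hν, DD, Fin.sum_univ_three]; simp
    refine ⟨dν ▸ DD_herm _ _, ?_⟩
    intro τ hτ
    obtain ⟨f, hf, hfτ⟩ := spec hτ
    have dτ := eq_DD hf hfτ
    have oτ := (ordEig_eq hτ).choose_spec.2
    have r := fun i => ray hf oτ (he.one i)
    rw [← dτ] at r
    have B := bound_aux ha hb (r 0) (r 1) (r 2) xa yx zy bz s
    have E1 : frob ν τ = x * (e 0 ⬝ᵥ τ *ᵥ e 0) + y * (e 1 ⬝ᵥ τ *ᵥ e 1) + z * (e 2 ⬝ᵥ τ *ᵥ e 2) := by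
      rw [dν, frob_DD, Fin.sum_univ_three]; simp
    have E2 : frob ν η = x * ω₁ η + y * ω₂ η + z * ω₃ η := by
      rw [dν, frob_DD, Fin.sum_univ_three]
      simp only [quad_eig (he.one _) (heη _)]
      simp [ω₁, ω₂, ω₃]
    rw [frob_sub, E1, E2]
    have hy : y = a - b - x - z := by linarith
    change _ ≤ a * ordEig τ 0 - b * ordEig τ 2
    refine le_trans (le_of_eq ?_) B
    subst hy
    linear_combination -k1 + k3
end

section
/- Let ν, η ∈ Sym3 and let ν = ν₁·f₁f₁ᵀ + ν₂·f₂f₂ᵀ + ν₃·f₃f₃ᵀ be a spectral decomposition of ν with ν₁ ≥ ν₂ ≥ ν₃ and (f₁,f₂,f₃) an orthonormal basis of eigenvectors. Set τᵢ = ⟨η·fᵢ, fᵢ⟩ for i = 1,2,3. If (τ₁ − ω₁(η))·(ν₁ − ν₂) = 0 and (τ₃ − ω₃(η))·(ν₂ − ν₃) = 0, then there exists a triple (e₁, e₂, e₃) ∈ V(η) such that ν = ν₁·e₁e₁ᵀ + ν₂·e₂e₂ᵀ + ν₃·e₃e₃ᵀ; that is, ν and η are simultaneously diagonalized by an orthonormal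 eigenbasis of η ordered by decreasing eigenvalues. -/
open Matrix

def ON (e : Fin 3 → (Fin 3 → ℝ)) : Prop :=
  ∀ i j, e i ⬝ᵥ e j = if i = j then (1 : ℝ) else 0

lemma ON.mul_transpose {e : Fin 3 → (Fin 3 → ℝ)} (h : ON e) :
    (Matrix.of e : Mat3) * (Matrix.of e : Mat3)ᵀ = 1 := by
  ext i j
  rw [Matrix.mul_apply', Matrix.one_apply]
  exact h i j

lemma ON.transpose_mul {e : Fin 3 → (Fin 3 → ℝ)} (h : ON e) :
    (Matrix.of e : Mat3)ᵀ * (Matrix.of e : Mat3) = 1 :=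
  mul_eq_one_comm.mp h.mul_transpose

lemma ON.sum_eq {e : Fin 3 → (Fin 3 → ℝ)} (h : ON e) :
    vecMulVec (e 0) (e 0) + vecMulVec (e 1) (e 1) + vecMulVec (e 2) (e 2) = (1 : Mat3) := by
  rw [← h.transpose_mul]
  ext i j
  simp [Matrix.mul_apply, Fin.sum_univ_three, vecMulVec_apply]

lemma ON.expand {e : Fin 3 → (Fin 3 → ℝ)} (h : ON e) (x : Fin 3 → ℝ) :
    x = (e 0 ⬝ᵥ x) • e 0 + (e 1 ⬝ᵥ x) • e 1 + (e 2 ⬝ᵥ x) • e 2 := by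
  have := congrArg (fun M : Mat3 => M *ᵥ x) h.sum_eq
  simp only [Matrix.add_mulVec, Matrix.vecMulVec_mulVec, Matrix.one_mulVec] at this
  simpa using this.symm

lemma eta_eq {η : Mat3} {e : Fin 3 → (Fin 3 → ℝ)} {l : Fin 3 → ℝ} (h : ON e)
    (he : ∀ i, η *ᵥ (e i) = l i • e i) :
    η = (Matrix.of e : Mat3)ᵀ * Matrix.diagonal l * (Matrix.of e : Mat3) := by
  have h1 : η * (Matrix.of e : Mat3)ᵀ = (Matrix.of e : Mat3)ᵀ * Matrix.diagonal l := by
    ext i j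
    have := congrFun (he j) i
    rw [Matrix.mul_diagonal, Matrix.mul_apply']
    simpa [Matrix.mulVec, mul_comm] using this
  rw [← h1, mul_assoc, h.transpose_mul, mul_one]

lemma ordEig_eq_s6 {η : Mat3} (hη : η.IsHermitian) {e : Fin 3 → (Fin 3 → ℝ)} {l : Fin 3 → ℝ}
    (h : ON e) (he : ∀ i, η *ᵥ (e i) = l i • e i) (hl : Antitone l) (i : Fin 3) :
    ordEig η i = l i := by
  have hc : η.charpoly = (Matrix.diagonal l).charpoly := by
    rw [eta_eq h he, Matrix.charpoly_mul_comm, ← mul_assoc, h.mul_transpose, one_mul]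
  have hr : η.charpoly.roots = Multiset.map l Finset.univ.val := by
    rw [hc, Matrix.charpoly_diagonal]
    exact Polynomial.roots_multiset_prod_X_sub_C (Multiset.map l Finset.univ.val) |>.symm ▸ (by
      simp [Finset.prod])
  have hr2 : η.charpoly.roots = Multiset.map hη.eigenvalues Finset.univ.val := by
    simpa using hη.roots_charpoly_eq_eigenvalues
  have hp : (List.ofFn hη.eigenvalues).Perm (List.ofFn l) := by
    rw [← Multiset.coe_eq_coe, ← Fin.univ_val_map, ← Fin.univ_val_map, ← hr, hr2]
  have hs : List.insertionSort (· ≥ ·) (List.ofFn hη.eigenvalues) = List.ofFn l := by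
    refine List.Perm.eq_of_pairwise' (r := (· ≥ ·)) (List.pairwise_insertionSort _ _) ?_
      ((List.perm_insertionSort _ _).trans hp)
    exact hl.sortedGE_ofFn.pairwise
  rw [ordEig, dif_pos hη, hs]
  fin_cases i <;> simp

lemma exists_V {η : Mat3} (hη : η.IsHermitian) :
    ∃ g, ON g ∧ (∀ i, η *ᵥ (g i) = ordEig η i • g i) ∧ Antitone (ordEig η) := by
  let σ := Tuple.sort (fun i => - hη.eigenvalues i)
  have hσ := Tuple.monotone_sort (fun i => - hη.eigenvalues i)
  let g : Fin 3 → (Fin 3 → ℝ) := fun i => (hη.eigenvectorBasis (σ i)).ofLp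
  have hl : Antitone (fun i => hη.eigenvalues (σ i)) := fun i j hij => by
    have := hσ hij
    simp only [Function.comp] at this
    exact neg_le_neg_iff.mp this
  have hg : ON g := fun i j => by
    have := orthonormal_iff_ite.mp hη.eigenvectorBasis.orthonormal (σ j) (σ i)
    rw [EuclideanSpace.inner_eq_star_dotProduct] at this
    simp only [star_trivial, σ.injective.eq_iff] at this
    simpa [g, eq_comm] using this
  have he : ∀ i, η *ᵥ (g i) = hη.eigenvalues (σ i) • g i := fun i =>
    hη.mulVec_eigenvectorBasis (σ i)
  have ho := ordEig_eq_s6 hη hg he hl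
  refine ⟨g, hg, fun i => by rw [ho, he], ?_⟩
  rw [funext ho]; exact hl

lemma psd_top {η : Mat3} (hη : η.IsHermitian) : (ordEig η 0 • (1 : Mat3) - η).PosSemidef := by
  obtain ⟨g, hg, he, ha⟩ := exists_V hη
  have : ordEig η 0 • (1 : Mat3) - η = (Matrix.of g : Mat3)ᴴ *
      Matrix.diagonal (fun i => ordEig η 0 - ordEig η i) * (Matrix.of g : Mat3) :=
    eta_eq hg (fun i => by simp [Matrix.sub_mulVec, Matrix.smul_mulVec, he, sub_smul])
  rw [this]
  apply Matrix.PosSemidef.conjTranspose_mul_mul_same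
  exact Matrix.PosSemidef.diagonal fun i => sub_nonneg.mpr (ha (Fin.zero_le i))

lemma psd_bot {η : Mat3} (hη : η.IsHermitian) : (η - ordEig η 2 • (1 : Mat3)).PosSemidef := by
  obtain ⟨g, hg, he, ha⟩ := exists_V hη
  have : η - ordEig η 2 • (1 : Mat3) = (Matrix.of g : Mat3)ᴴ *
      Matrix.diagonal (fun i => ordEig η i - ordEig η 2) * (Matrix.of g : Mat3) :=
    eta_eq hg (fun i => by simp [Matrix.sub_mulVec, Matrix.smul_mulVec, he, sub_smul])
  rw [this]
  apply Matrix.PosSemidef.conjTranspose_mul_mul_same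
  exact Matrix.PosSemidef.diagonal fun i => sub_nonneg.mpr (ha (Fin.le_last i))

lemma ray_top_s6 {η : Mat3} (hη : η.IsHermitian) {x : Fin 3 → ℝ} (hx : x ⬝ᵥ x = 1) :
    x ⬝ᵥ η *ᵥ x ≤ ordEig η 0 := by
  have := (psd_top hη).dotProduct_mulVec_nonneg x
  simp [Matrix.sub_mulVec, Matrix.smul_mulVec, dotProduct_sub, hx] at this
  exact this

lemma ray_bot_s6 {η : Mat3} (hη : η.IsHermitian) {x : Fin 3 → ℝ} (hx : x ⬝ᵥ x = 1) :
    ordEig η 2 ≤ x ⬝ᵥ η *ᵥ x := by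
  have := (psd_bot hη).dotProduct_mulVec_nonneg x
  simp [Matrix.sub_mulVec, Matrix.smul_mulVec, dotProduct_sub, hx] at this
  exact this

lemma eig_top {η : Mat3} (hη : η.IsHermitian) {x : Fin 3 → ℝ} (hx : x ⬝ᵥ x = 1)
    (h : x ⬝ᵥ η *ᵥ x = ordEig η 0) : η *ᵥ x = ordEig η 0 • x := by
  have := ((psd_top hη).dotProduct_mulVec_zero_iff x).mp
    (by simp [Matrix.sub_mulVec, Matrix.smul_mulVec, dotProduct_sub, hx, h])
  simp [Matrix.sub_mulVec, Matrix.smul_mulVec, sub_eq_zero] at this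
  exact this.symm

lemma eig_bot {η : Mat3} (hη : η.IsHermitian) {x : Fin 3 → ℝ} (hx : x ⬝ᵥ x = 1)
    (h : x ⬝ᵥ η *ᵥ x = ordEig η 2) : η *ᵥ x = ordEig η 2 • x := by
  have := ((psd_bot hη).dotProduct_mulVec_zero_iff x).mp
    (by simp [Matrix.sub_mulVec, Matrix.smul_mulVec, dotProduct_sub, hx, h])
  simp [Matrix.sub_mulVec, Matrix.smul_mulVec, sub_eq_zero] at this
  exact this

lemma symm_dot {η : Mat3} (hη : η.IsHermitian) (x y : Fin 3 → ℝ) :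
    x ⬝ᵥ η *ᵥ y = y ⬝ᵥ η *ᵥ x := by
  have ht : ηᵀ = η := by simpa using hη.eq
  rw [Matrix.dotProduct_mulVec, ← Matrix.mulVec_transpose, ht, dotProduct_comm]

lemma rot (a b d : ℝ) : ∃ c s : ℝ, c ^ 2 + s ^ 2 = 1 ∧ b * (c ^ 2 - s ^ 2) - (a - d) * (c * s) = 0 ∧
    0 ≤ (a - d) * (c ^ 2 - s ^ 2) + 4 * b * (c * s) := by
  let z : ℂ := ⟨a - d, 2 * b⟩
  have h1 : ‖z‖ * Real.cos z.arg = a - d := Complex.norm_mul_cos_arg z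
  have h2 : ‖z‖ * Real.sin z.arg = 2 * b := Complex.norm_mul_sin_arg z
  have e : z.arg = 2 * (z.arg / 2) := by ring
  have h0 := norm_nonneg z
  rw [e, Real.cos_two_mul] at h1
  rw [e, Real.sin_two_mul] at h2
  have hcs := Real.cos_sq_add_sin_sq (z.arg / 2)
  refine ⟨Real.cos (z.arg / 2), Real.sin (z.arg / 2), hcs, ?_, ?_⟩
  all_goals
    generalize Real.cos (z.arg / 2) = c at *
    generalize Real.sin (z.arg / 2) = s at *
    generalize ‖z‖ = r at *
    have hs : s ^ 2 = 1 - c ^ 2 := by linarith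
    have hb : b = r * (s * c) := by linarith
    rw [← h1, hb, hs]
  · ring
  · have : r * (2 * c ^ 2 - 1) * (c ^ 2 - (1 - c ^ 2)) + 4 * (r * (s * c)) * (c * s)
      = r * ((2 * c ^ 2 - 1) ^ 2 + 4 * c ^ 2 * s ^ 2) := by ring
    rw [this]; positivity

lemma ON_of {p q v : Fin 3 → ℝ} (pp : p ⬝ᵥ p = 1) (qq : q ⬝ᵥ q = 1) (vv : v ⬝ᵥ v = 1)
    (pq : p ⬝ᵥ q = 0) (pv : p ⬝ᵥ v = 0) (qv : q ⬝ᵥ v = 0) : ON ![p, q, v] := by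
  intro i j
  fin_cases i <;> fin_cases j <;>
    simp [pp, qq, vv, pq, pv, qv, dotProduct_comm q p, dotProduct_comm v p, dotProduct_comm v q]

lemma diag2 {η : Mat3} (hη : η.IsHermitian) {p q v : Fin 3 → ℝ} {w : ℝ}
    (pp : p ⬝ᵥ p = 1) (qq : q ⬝ᵥ q = 1) (vv : v ⬝ᵥ v = 1)
    (pq : p ⬝ᵥ q = 0) (pv : p ⬝ᵥ v = 0) (qv : q ⬝ᵥ v = 0) (hv : η *ᵥ v = w • v) :
    ∃ p' q' : Fin 3 → ℝ, ∃ α β : ℝ, β ≤ α ∧ p' ⬝ᵥ p' = 1 ∧ q' ⬝ᵥ q' = 1 ∧ p' ⬝ᵥ q' = 0 ∧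
      p' ⬝ᵥ v = 0 ∧ q' ⬝ᵥ v = 0 ∧ η *ᵥ p' = α • p' ∧ η *ᵥ q' = β • q' := by
  obtain ⟨c, s, hcs, ho, hn⟩ := rot (p ⬝ᵥ η *ᵥ p) (p ⬝ᵥ η *ᵥ q) (q ⬝ᵥ η *ᵥ q)
  have qp : q ⬝ᵥ p = 0 := by rw [dotProduct_comm, pq]
  have hqp : q ⬝ᵥ η *ᵥ p = p ⬝ᵥ η *ᵥ q := symm_dot hη _ _
  obtain ⟨p', hp'⟩ : ∃ p', p' = c • p + s • q := ⟨_, rfl⟩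
  obtain ⟨q', hq'⟩ : ∃ q', q' = (-s) • p + c • q := ⟨_, rfl⟩
  have pp' : p' ⬝ᵥ p' = 1 := by
    simp only [hp', add_dotProduct, dotProduct_add, smul_dotProduct, dotProduct_smul, smul_eq_mul,
      pp, qq, pq, qp]
    linarith
  have qq' : q' ⬝ᵥ q' = 1 := by
    simp only [hq', add_dotProduct, dotProduct_add, smul_dotProduct, dotProduct_smul, smul_eq_mul,
      pp, qq, pq, qp]
    linarith
  have pq' : p' ⬝ᵥ q' = 0 := by
    simp only [hp', hq', add_dotProduct, dotProduct_add, smul_dotProduct, dotProduct_smul,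
      smul_eq_mul, pp, qq, pq, qp]
    ring
  have pv' : p' ⬝ᵥ v = 0 := by
    simp [hp', add_dotProduct, smul_dotProduct, pv, qv]
  have qv' : q' ⬝ᵥ v = 0 := by
    simp [hq', add_dotProduct, smul_dotProduct, pv, qv]
  have hoff : p' ⬝ᵥ η *ᵥ q' = 0 := by
    simp only [hp', hq', Matrix.mulVec_add, Matrix.mulVec_smul, add_dotProduct, dotProduct_add,
      smul_dotProduct, dotProduct_smul, smul_eq_mul, hqp]
    linarith
  have hoff' : q' ⬝ᵥ η *ᵥ p' = 0 := by rw [symm_dot hη, hoff]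
  have hvp : v ⬝ᵥ η *ᵥ p' = 0 := by rw [symm_dot hη, hv]; simp [pv']
  have hvq : v ⬝ᵥ η *ᵥ q' = 0 := by rw [symm_dot hη, hv]; simp [qv']
  have hON := ON_of pp' qq' vv pq' pv' qv'
  refine ⟨p', q', p' ⬝ᵥ η *ᵥ p', q' ⬝ᵥ η *ᵥ q', ?_, pp', qq', pq', pv', qv', ?_, ?_⟩
  · rw [← sub_nonneg]
    simp only [hp', hq', Matrix.mulVec_add, Matrix.mulVec_smul, add_dotProduct, dotProduct_add,
      smul_dotProduct, dotProduct_smul, smul_eq_mul, hqp]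
    linarith
  · have := hON.expand (η *ᵥ p')
    simpa [hoff', hvp] using this
  · have := hON.expand (η *ᵥ q')
    simpa [hoff, hvq] using this

lemma anti3_s6 {a b c : ℝ} (h1 : b ≤ a) (h2 : c ≤ b) : Antitone ![a, b, c] := by
  intro i j hij
  fin_cases i <;> fin_cases j <;> simp at hij ⊢ <;> linarith

lemma mem_V {η : Mat3} (hη : η.IsHermitian) {p q v : Fin 3 → ℝ} {a b c : ℝ}
    (h : ON ![p, q, v]) (hp : η *ᵥ p = a • p) (hq : η *ᵥ q = b • q) (hv : η *ᵥ v = c • v)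
    (h1 : b ≤ a) (h2 : c ≤ b) : ![p, q, v] ∈ Vset η := by
  have he : ∀ i, η *ᵥ (![p, q, v] i) = ![a, b, c] i • ![p, q, v] i := by
    intro i; fin_cases i <;> simp [hp, hq, hv]
  exact ⟨h, fun i => by rw [ordEig_eq_s6 hη h he (anti3_s6 h1 h2), he]⟩

/-- if `ν = Σ νᵢ fᵢfᵢᵀ` is a spectral decomposition of `ν` with `ν₁ ≥ ν₂ ≥ ν₃`
and orthonormal `(f₁,f₂,f₃)`, `τᵢ = ⟨η·fᵢ, fᵢ⟩`, and `(τ₁ − ω₁(η))(ν₁ − ν₂) = 0`,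
`(τ₃ − ω₃(η))(ν₂ − ν₃) = 0`, then `ν` and `η` are simultaneously diagonalized by some
ordered orthonormal eigenbasis `(e₁,e₂,e₃) ∈ V(η)` of `η`. -/
theorem simultaneous_diagonalization (η ν : Mat3) (hη : η.IsHermitian) (hν : ν.IsHermitian)
    (ν₁ ν₂ ν₃ : ℝ) (f : Fin 3 → (Fin 3 → ℝ))
    (horth : ∀ i j, f i ⬝ᵥ f j = if i = j then (1 : ℝ) else 0)
    (hdec : ν₂ ≤ ν₁ ∧ ν₃ ≤ ν₂)
    (hdecomp : ν = ν₁ • vecMulVec (f 0) (f 0) + ν₂ • vecMulVec (f 1) (f 1) +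
        ν₃ • vecMulVec (f 2) (f 2))
    (h1 : (η.mulVec (f 0) ⬝ᵥ f 0 - ω₁ η) * (ν₁ - ν₂) = 0)
    (h3 : (η.mulVec (f 2) ⬝ᵥ f 2 - ω₃ η) * (ν₂ - ν₃) = 0) :
    ∃ e ∈ Vset η,
      ν = ν₁ • vecMulVec (e 0) (e 0) + ν₂ • vecMulVec (e 1) (e 1) +
          ν₃ • vecMulVec (e 2) (e 2) := by
  have hf : ON f := horth
  have hsum := hf.sum_eq
  have f00 : f 0 ⬝ᵥ f 0 = 1 := by simp [horth]
  have f11 : f 1 ⬝ᵥ f 1 = 1 := by simp [horth]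
  have f22 : f 2 ⬝ᵥ f 2 = 1 := by simp [horth]
  have f01 : f 0 ⬝ᵥ f 1 = 0 := by simp [horth]
  have f02 : f 0 ⬝ᵥ f 2 = 0 := by simp [horth]
  have f12 : f 1 ⬝ᵥ f 2 = 0 := by simp [horth]
  have f10 : f 1 ⬝ᵥ f 0 = 0 := by simp [horth]
  have f20 : f 2 ⬝ᵥ f 0 = 0 := by simp [horth]
  have top : ν₁ ≠ ν₂ → η *ᵥ f 0 = ordEig η 0 • f 0 := fun hne => by
    refine eig_top hη f00 ?_
    rw [dotProduct_comm]
    exact sub_eq_zero.mp ((mul_eq_zero.mp h1).resolve_right (sub_ne_zero.mpr hne))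
  have bot : ν₂ ≠ ν₃ → η *ᵥ f 2 = ordEig η 2 • f 2 := fun hne => by
    refine eig_bot hη f22 ?_
    rw [dotProduct_comm]
    exact sub_eq_zero.mp ((mul_eq_zero.mp h3).resolve_right (sub_ne_zero.mpr hne))
  by_cases h12 : ν₁ = ν₂
  · by_cases h23 : ν₂ = ν₃
    · obtain ⟨g, hg, he, -⟩ := exists_V hη
      refine ⟨g, ⟨hg, he⟩, ?_⟩
      rw [hdecomp, h12, h23, ← smul_add, ← smul_add, ← smul_add, ← smul_add, hsum, hg.sum_eq]
    · obtain ⟨p, q, α, β, hab, pp, qq, pq, pv, qv, hp, hq⟩ :=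
        diag2 hη f00 f11 f22 f01 f02 f12 (bot h23)
      have hON := ON_of pp qq f22 pq pv qv
      have hβ : ordEig η 2 ≤ β := by
        have := ray_bot_s6 hη qq
        simpa [hq, qq] using this
      refine ⟨![p, q, f 2], mem_V hη hON hp hq (bot h23) hab hβ, ?_⟩
      have hs := hON.sum_eq
      rw [hdecomp, h12, ← smul_add, ← smul_add, eq_sub_of_add_eq hsum, eq_sub_of_add_eq hs]
      simp
  · by_cases h23 : ν₂ = ν₃
    · obtain ⟨p, q, α, β, hab, pp, qq, pq, pv, qv, hp, hq⟩ :=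
        diag2 hη f11 f22 f00 f12 f10 f20 (top h12)
      have hON : ON ![f 0, p, q] := ON_of f00 pp qq (by rw [dotProduct_comm, pv])
        (by rw [dotProduct_comm, qv]) pq
      have hα : α ≤ ordEig η 0 := by
        have := ray_top_s6 hη pp
        simpa [hp, pp] using this
      refine ⟨![f 0, p, q], mem_V hη hON (top h12) hp hq hα hab, ?_⟩
      have hs := hON.sum_eq
      rw [add_assoc] at hs hsum
      rw [hdecomp, h23, add_assoc, add_assoc, ← smul_add, ← smul_add, eq_sub_of_add_eq' hsum,
        eq_sub_of_add_eq' hs]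
      simp
    · have t := top h12
      have b := bot h23
      have m : η *ᵥ f 1 = (f 1 ⬝ᵥ η *ᵥ f 1) • f 1 := by
        have := hf.expand (η *ᵥ f 1)
        rw [symm_dot hη (f 0), symm_dot hη (f 2), t, b] at this
        simpa [f10, f12] using this
      have hON := ON_of f00 f11 f22 f01 f02 f12
      exact ⟨![f 0, f 1, f 2], mem_V hη hON t m b (ray_top_s6 hη f11) (ray_bot_s6 hη f11),
        by simpa using hdecomp⟩
end

section
/- Fix K, G > 0, c₀ > 0, φ, ψ ∈ (0, π/2), a nondecreasing continuous function H : ℝ → ℝ with H(0) = 0, real numbers σ₁ᵗʳ ≥ σ₂ᵗʳ ≥ σ₃ᵗʳ and ε̄ᵗʳ ∈ ℝ. Then the function q : [0,∞) → ℝ (defined piecewise by the two explicit formulas according to whether γ_sl ≤ γ_sr or γ_sr < γ_sl) is continuous, strictly decreasing on [0,∞), satisfies q(0) = (1+sin φ)σ₁ᵗʳ − (1−sin φ)σ₃ᵗʳ − 2(c₀ + H(ε̄ᵗʳ))cos φ, and q(γ) → −∞ as γ → +∞. -/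
lemma q_aux (A B a b x y c e k d : ℝ) (H : ℝ → ℝ) (hmono : Monotone H) (hcont : Continuous H)
    (ha : 0 ≤ a) (hb : 0 ≤ b) (hx : 0 ≤ x) (hy : 0 ≤ y) (hk : 0 ≤ k) (hd : 0 < d)
    (hB : B = a + b + d) (q : ℝ → ℝ)
    (hq : ∀ γ : ℝ, q γ = A - γ * B + a * max (γ - x) 0 + b * max (γ - y) 0
      - 2 * (c + H (e + 2 * γ * k)) * k) :
    ContinuousOn q (Set.Ici 0) ∧ StrictAntiOn q (Set.Ici 0) ∧
    q 0 = A - 2 * (c + H e) * k ∧ Filter.Tendsto q Filter.atTop Filter.atBot := by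
  have hmax : ∀ u v z : ℝ, u ≤ v → max (v - z) 0 ≤ max (u - z) 0 + (v - u) := by
    intro u v z h
    apply max_le
    · linarith [le_max_left (u - z) 0]
    · linarith [le_max_right (u - z) 0]
  have key : ∀ u v : ℝ, u ≤ v → q v ≤ q u - d * (v - u) := by
    intro u v h
    have h1 := mul_le_mul_of_nonneg_left (hmax u v x h) ha
    have h2 := mul_le_mul_of_nonneg_left (hmax u v y h) hb
    have h3 : H (e + 2 * u * k) ≤ H (e + 2 * v * k) := by
      apply hmono
      nlinarith [mul_le_mul_of_nonneg_right h hk]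
    have h4 := mul_le_mul_of_nonneg_right h3 hk
    rw [hq u, hq v, hB]
    linarith
  refine ⟨?_, ?_, ?_, ?_⟩
  · have : q = _ := funext hq
    rw [this]
    apply Continuous.continuousOn
    fun_prop
  · intro u _ v _ h
    have := key u v h.le
    have := mul_pos hd (sub_pos.2 h)
    linarith
  · rw [hq, max_eq_right (by linarith), max_eq_right (by linarith)]
    simp
  · have ht : Filter.Tendsto (fun v : ℝ => q 0 + -(d * v)) Filter.atTop Filter.atBot :=
      Filter.tendsto_atBot_add_const_left _ _
        (Filter.tendsto_neg_atTop_atBot.comp (Filter.tendsto_id.const_mul_atTop hd))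
    refine Filter.tendsto_atBot_mono' _ ?_ ht
    filter_upwards [Filter.eventually_ge_atTop 0] with v hv
    have := key 0 v hv
    linarith

/-- Lemma 4.2 of the paper: the piecewise function `q` of the incremental
Mohr–Coulomb problem is continuous and strictly decreasing on `[0,∞)`, takes the value
`f(σᵗʳ, H(ε̄ᵗʳ))` at `0`, and tends to `−∞` at `+∞`. -/
theorem q_properties (K G c₀ φ ψ : ℝ) (hK : 0 < K) (hG : 0 < G) (hc₀ : 0 < c₀)
    (hφ : φ ∈ Set.Ioo 0 (Real.pi / 2)) (hψ : ψ ∈ Set.Ioo 0 (Real.pi / 2))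
    (H : ℝ → ℝ) (hmono : Monotone H) (hcont : Continuous H) (hH0 : H 0 = 0)
    (σ1 σ2 σ3 εtr : ℝ) (hord : σ2 ≤ σ1 ∧ σ3 ≤ σ2)
    (γsl γsr γla γra : ℝ)
    (hsl : γsl = (σ1 - σ2) / (2 * G * (1 + Real.sin ψ)))
    (hsr : γsr = (σ2 - σ3) / (2 * G * (1 - Real.sin ψ)))
    (hla : γla = (σ1 + σ2 - 2 * σ3) / (2 * G * (3 - Real.sin ψ)))
    (hra : γra = (2 * σ1 - σ2 - σ3) / (2 * G * (3 + Real.sin ψ)))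
    (q : ℝ → ℝ)
    (hq : ∀ γ : ℝ, q γ =
      if γsl ≤ γsr then
        (1 + Real.sin φ) * σ1 - (1 - Real.sin φ) * σ3
          - γ * ((4 / 3) * (3 * K - 2 * G) * Real.sin ψ * Real.sin φ
                  + 4 * G * (1 + Real.sin ψ * Real.sin φ))
          + G * (1 + Real.sin ψ) * (1 + Real.sin φ) * max (γ - γsl) 0
          + (1 / 3) * G * (3 - Real.sin ψ) * (3 - Real.sin φ) * max (γ - γla) 0
          - 2 * (c₀ + H (εtr + 2 * γ * Real.cos φ)) * Real.cos φ
      else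
        (1 + Real.sin φ) * σ1 - (1 - Real.sin φ) * σ3
          - γ * ((4 / 3) * (3 * K - 2 * G) * Real.sin ψ * Real.sin φ
                  + 4 * G * (1 + Real.sin ψ * Real.sin φ))
          + G * (1 - Real.sin ψ) * (1 - Real.sin φ) * max (γ - γsr) 0
          + (1 / 3) * G * (3 + Real.sin ψ) * (3 + Real.sin φ) * max (γ - γra) 0
          - 2 * (c₀ + H (εtr + 2 * γ * Real.cos φ)) * Real.cos φ) :
    ContinuousOn q (Set.Ici 0) ∧
    StrictAntiOn q (Set.Ici 0) ∧
    q 0 = (1 + Real.sin φ) * σ1 - (1 - Real.sin φ) * σ3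
            - 2 * (c₀ + H εtr) * Real.cos φ ∧
    Filter.Tendsto q Filter.atTop Filter.atBot := by
  obtain ⟨h21, h32⟩ := hord
  have hpi := Real.pi_pos
  have hs : 0 < Real.sin ψ := Real.sin_pos_of_pos_of_lt_pi hψ.1 (by linarith [hψ.2])
  have ht : 0 < Real.sin φ := Real.sin_pos_of_pos_of_lt_pi hφ.1 (by linarith [hφ.2])
  have hs1 := Real.sin_le_one ψ
  have ht1 := Real.sin_le_one φ
  have hk : 0 ≤ Real.cos φ :=
    Real.cos_nonneg_of_neg_pi_div_two_le_of_le (by linarith [hφ.1]) hφ.2.le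
  have hd : 0 < 4 * K * Real.sin ψ * Real.sin φ := by positivity
  have e1 : 0 ≤ 1 - Real.sin ψ := by linarith
  have e2 : 0 ≤ 1 - Real.sin φ := by linarith
  have e3 : 0 ≤ 3 - Real.sin ψ := by linarith
  have e4 : 0 ≤ 3 - Real.sin φ := by linarith
  by_cases hc : γsl ≤ γsr
  · simp only [if_pos hc] at hq
    refine q_aux _ _ _ _ γsl γla c₀ εtr _ _ H hmono hcont (by positivity) (by positivity)
      ?_ ?_ hk hd ?_ q hq
    · rw [hsl]; exact div_nonneg (by linarith) (by positivity)
    · rw [hla]; exact div_nonneg (by linarith) (by positivity)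
    · ring
  · simp only [if_neg hc] at hq
    refine q_aux _ _ _ _ γsr γra c₀ εtr _ _ H hmono hcont (by positivity) (by positivity)
      ?_ ?_ hk hd ?_ q hq
    · rw [hsr]; exact div_nonneg (by linarith) (by positivity)
    · rw [hra]; exact div_nonneg (by linarith) (by positivity)
    · ring
end

section
/- Fix K, G > 0, c₀ > 0, φ, ψ ∈ (0, π/2), a nondecreasing continuous function H : ℝ → ℝ with H(0) = 0, real numbers σ₁ᵗʳ ≥ σ₂ᵗʳ ≥ σ₃ᵗʳ and ε̄ᵗʳ ∈ ℝ, and assume γ_sl ≤ γ_sr (so that γ_sl ≤ γ_la ≤ γ_sr). Then the function q defined by the first explicit formula satisfies: q(γ) = q_s(γ) for all γ ∈ [0, γ_sl], q(γ) = q_l(γ) for all γ ∈ [γ_sl, γ_la], and q(γ) = q_a(γ) for all γ ∈ [γ_la, ∞). -/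
/-- when `γ_sl ≤ γ_sr`, the unified function `q` coincides with `q_s` on
`[0, γ_sl]`, with `q_l` on `[γ_sl, γ_la]`, and with `q_a` on `[γ_la, ∞)`. -/
theorem q_piecewise_agreement (K G c₀ φ ψ : ℝ) (hK : 0 < K) (hG : 0 < G) (hc₀ : 0 < c₀)
    (hφ : φ ∈ Set.Ioo 0 (Real.pi / 2)) (hψ : ψ ∈ Set.Ioo 0 (Real.pi / 2))
    (H : ℝ → ℝ) (hmono : Monotone H) (hcont : Continuous H) (hH0 : H 0 = 0)
    (σ1 σ2 σ3 εtr : ℝ) (hord : σ2 ≤ σ1 ∧ σ3 ≤ σ2)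
    (γsl γsr γla : ℝ)
    (hsl : γsl = (σ1 - σ2) / (2 * G * (1 + Real.sin ψ)))
    (hsr : γsr = (σ2 - σ3) / (2 * G * (1 - Real.sin ψ)))
    (hla : γla = (σ1 + σ2 - 2 * σ3) / (2 * G * (3 - Real.sin ψ)))
    (hcase : γsl ≤ γsr)
    (qs ql qa q : ℝ → ℝ)
    (hqs : ∀ γ : ℝ, qs γ =
      (1 + Real.sin φ) * σ1 - (1 - Real.sin φ) * σ3
        - 2 * (c₀ + H (εtr + 2 * γ * Real.cos φ)) * Real.cos φ
        - γ * ((4 / 3) * (3 * K - 2 * G) * Real.sin ψ * Real.sin φ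
                + 4 * G * (1 + Real.sin ψ * Real.sin φ)))
    (hql : ∀ γ : ℝ, ql γ =
      (1 / 2) * (1 + Real.sin φ) * (σ1 + σ2) - (1 - Real.sin φ) * σ3
        - 2 * (c₀ + H (εtr + 2 * γ * Real.cos φ)) * Real.cos φ
        - γ * ((4 / 3) * (3 * K - 2 * G) * Real.sin ψ * Real.sin φ
                + G * (1 + Real.sin ψ) * (1 + Real.sin φ)
                + 2 * G * (1 - Real.sin ψ) * (1 - Real.sin φ)))
    (hqa : ∀ γ : ℝ, qa γ =
      (2 / 3) * (σ1 + σ2 + σ3) * Real.sin φ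
        - 2 * (c₀ + H (εtr + 2 * γ * Real.cos φ)) * Real.cos φ
        - 4 * γ * K * Real.sin ψ * Real.sin φ)
    (hq : ∀ γ : ℝ, q γ = qs γ
        + G * (1 + Real.sin ψ) * (1 + Real.sin φ) * max (γ - γsl) 0
        + (1 / 3) * G * (3 - Real.sin ψ) * (3 - Real.sin φ) * max (γ - γla) 0) :
    (∀ γ ∈ Set.Icc (0 : ℝ) γsl, q γ = qs γ) ∧
    (∀ γ ∈ Set.Icc γsl γla, q γ = ql γ) ∧
    (∀ γ ∈ Set.Ici γla, q γ = qa γ) := by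
  have hs1 : Real.sin ψ < 1 := by
    have h := Real.sin_lt_sin_of_lt_of_le_pi_div_two
      (by linarith [hψ.1, Real.pi_pos]) le_rfl hψ.2
    rwa [Real.sin_pi_div_two] at h
  have hs0 : 0 < Real.sin ψ :=
    Real.sin_pos_of_pos_of_lt_pi hψ.1 (by linarith [hψ.2, Real.pi_pos])
  generalize Real.sin ψ = s at *
  generalize Real.sin φ = f at *
  have e1 : γsl * (2 * G * (1 + s)) = σ1 - σ2 := by
    rw [hsl]; exact div_mul_cancel₀ _ (by positivity)
  have e2 : γsr * (2 * G * (1 - s)) = σ2 - σ3 := by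
    rw [hsr]; exact div_mul_cancel₀ _ (mul_pos (by positivity) (by linarith)).ne'
  have e3 : γla * (2 * G * (3 - s)) = σ1 + σ2 - 2 * σ3 := by
    rw [hla]; exact div_mul_cancel₀ _ (mul_pos (by positivity) (by linarith)).ne'
  have hle : γsl ≤ γla := by
    have hpos : 0 < 2 * G * (3 - s) := mul_pos (by positivity) (by linarith)
    have h2 : 0 ≤ (γsr - γsl) * (4 * G * (1 - s)) :=
      mul_nonneg (by linarith) (mul_nonneg (by positivity) (by linarith))
    refine le_of_mul_le_mul_right ?_ hpos
    linarith
  clear hsl hsr hla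
  refine ⟨fun γ h => ?_, fun γ h => ?_, fun γ h => ?_⟩
  · rw [hq, max_eq_right (by linarith [h.2]), max_eq_right (by linarith [h.2])]
    ring
  · rw [hq, hqs, hql, max_eq_left (by linarith [h.1]), max_eq_right (by linarith [h.2])]
    linear_combination (-(1 + f) / 2) * e1
  · have h' : γla ≤ γ := h
    rw [hq, hqs, hqa, max_eq_left (by linarith), max_eq_left (by linarith)]
    linear_combination (-(1 + f) / 2) * e1 - ((3 - f) / 6) * e3
end

section
/- Fix K, G > 0, c₀ > 0, φ, ψ ∈ (0, π/2), a nondecreasing continuous function H : ℝ → ℝ with H(0) = 0, real numbers σ₁ᵗʳ ≥ σ₂ᵗʳ ≥ σ₃ᵗʳ and ε̄ᵗʳ ∈ ℝ, and let q : [0,∞) → ℝ be the piecewise-defined function of the incremental Mohr–Coulomb problem. If q(0) ≥ 0, then the equation q(γ) = 0 has exactly one solution γ* in [0,∞); moreover γ* = 0 if and only if q(0) = 0; and if γ₁, γ₂ ≥ 0 satisfy γ₁ < γ₂, q(γ₁) > 0 and q(γ₂) < 0, then γ₁ < γ* < γ₂. -/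
theorem root_aux (q : ℝ → ℝ) (κ : ℝ) (hκ : 0 < κ) (hc : Continuous q)
    (hd : ∀ x y : ℝ, x ≤ y → q y ≤ q x - κ * (y - x)) (hq0 : 0 ≤ q 0) :
    ∃ γstar : ℝ, 0 ≤ γstar ∧ q γstar = 0 ∧
      (∀ γ : ℝ, 0 ≤ γ → q γ = 0 → γ = γstar) ∧
      (γstar = 0 ↔ q 0 = 0) ∧
      (∀ γ₁ γ₂ : ℝ, 0 ≤ γ₁ → 0 ≤ γ₂ → γ₁ < γ₂ → 0 < q γ₁ → q γ₂ < 0 →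
        γ₁ < γstar ∧ γstar < γ₂) := by
  have hanti : StrictAnti q := by
    intro x y hxy
    have h1 := hd x y hxy.le
    have h2 := mul_pos hκ (sub_pos.2 hxy)
    linarith
  have hb : 0 ≤ q 0 / κ := div_nonneg hq0 hκ.le
  have hqb : q (q 0 / κ) ≤ 0 := by
    have h1 := hd 0 _ hb
    have h2 : κ * (q 0 / κ - 0) = q 0 := by
      field_simp
      ring
    linarith
  obtain ⟨g, hg, hg0⟩ := intermediate_value_Icc' hb hc.continuousOn ⟨hqb, hq0⟩
  refine ⟨g, hg.1, hg0, ?_, ?_, ?_⟩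
  · intro γ _ h
    exact hanti.injective (h.trans hg0.symm)
  · constructor
    · intro h
      rwa [h] at hg0
    · intro h
      exact hanti.injective (hg0.trans h.symm)
  · intro a b _ _ _ ha hb
    exact ⟨hanti.lt_iff_gt.1 (by rw [hg0]; exact ha), hanti.lt_iff_gt.1 (by rw [hg0]; exact hb)⟩

theorem max_aux (x y c : ℝ) (h : x ≤ y) : max (y - c) 0 ≤ max (x - c) 0 + (y - x) := by
  apply max_le
  · have := le_max_left (x - c) 0
    linarith
  · have := le_max_right (x - c) 0
    linarith

/-- Theorem 4.3 of the paper: if `q(0) ≥ 0`, the equation `q(γ) = 0` has a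
unique solution `γ* ≥ 0`; `γ* = 0` iff `q(0) = 0`; and any bracket `q(γ₁) > 0 > q(γ₂)`
with `0 ≤ γ₁ < γ₂` localizes it: `γ₁ < γ* < γ₂`. -/
theorem q_unique_root (K G c₀ φ ψ : ℝ) (hK : 0 < K) (hG : 0 < G) (hc₀ : 0 < c₀)
    (hφ : φ ∈ Set.Ioo 0 (Real.pi / 2)) (hψ : ψ ∈ Set.Ioo 0 (Real.pi / 2))
    (H : ℝ → ℝ) (hmono : Monotone H) (hcont : Continuous H) (hH0 : H 0 = 0)
    (σ1 σ2 σ3 εtr : ℝ) (hord : σ2 ≤ σ1 ∧ σ3 ≤ σ2)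
    (γsl γsr γla γra : ℝ)
    (hsl : γsl = (σ1 - σ2) / (2 * G * (1 + Real.sin ψ)))
    (hsr : γsr = (σ2 - σ3) / (2 * G * (1 - Real.sin ψ)))
    (hla : γla = (σ1 + σ2 - 2 * σ3) / (2 * G * (3 - Real.sin ψ)))
    (hra : γra = (2 * σ1 - σ2 - σ3) / (2 * G * (3 + Real.sin ψ)))
    (q : ℝ → ℝ)
    (hq : ∀ γ : ℝ, q γ =
      if γsl ≤ γsr then
        (1 + Real.sin φ) * σ1 - (1 - Real.sin φ) * σ3
          - γ * ((4 / 3) * (3 * K - 2 * G) * Real.sin ψ * Real.sin φ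
                  + 4 * G * (1 + Real.sin ψ * Real.sin φ))
          + G * (1 + Real.sin ψ) * (1 + Real.sin φ) * max (γ - γsl) 0
          + (1 / 3) * G * (3 - Real.sin ψ) * (3 - Real.sin φ) * max (γ - γla) 0
          - 2 * (c₀ + H (εtr + 2 * γ * Real.cos φ)) * Real.cos φ
      else
        (1 + Real.sin φ) * σ1 - (1 - Real.sin φ) * σ3
          - γ * ((4 / 3) * (3 * K - 2 * G) * Real.sin ψ * Real.sin φ
                  + 4 * G * (1 + Real.sin ψ * Real.sin φ))
          + G * (1 - Real.sin ψ) * (1 - Real.sin φ) * max (γ - γsr) 0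
          + (1 / 3) * G * (3 + Real.sin ψ) * (3 + Real.sin φ) * max (γ - γra) 0
          - 2 * (c₀ + H (εtr + 2 * γ * Real.cos φ)) * Real.cos φ)
    (hq0 : 0 ≤ q 0) :
    ∃ γstar : ℝ, 0 ≤ γstar ∧ q γstar = 0 ∧
      (∀ γ : ℝ, 0 ≤ γ → q γ = 0 → γ = γstar) ∧
      (γstar = 0 ↔ q 0 = 0) ∧
      (∀ γ₁ γ₂ : ℝ, 0 ≤ γ₁ → 0 ≤ γ₂ → γ₁ < γ₂ → 0 < q γ₁ → q γ₂ < 0 →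
        γ₁ < γstar ∧ γstar < γ₂) := by
  have hs0 : 0 < Real.sin ψ := Real.sin_pos_of_pos_of_lt_pi hψ.1 (by linarith [hψ.2, Real.pi_pos])
  have ht0 : 0 < Real.sin φ := Real.sin_pos_of_pos_of_lt_pi hφ.1 (by linarith [hφ.2, Real.pi_pos])
  have hcφ : 0 < Real.cos φ := Real.cos_pos_of_mem_Ioo ⟨by linarith [hφ.1, Real.pi_pos], hφ.2⟩
  have hs1 := Real.sin_le_one ψ
  have ht1 := Real.sin_le_one φ
  refine root_aux q (4 * K * Real.sin ψ * Real.sin φ) (by positivity) ?_ ?_ hq0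
  · rw [funext hq]
    split_ifs <;> fun_prop
  · intro x y hxy
    have hH : H (εtr + 2 * x * Real.cos φ) ≤ H (εtr + 2 * y * Real.cos φ) := by
      apply hmono
      gcongr
    have hH' := mul_le_mul_of_nonneg_right hH hcφ.le
    rw [hq, hq]
    split_ifs
    · have e1 := mul_le_mul_of_nonneg_left (max_aux x y γsl hxy)
        (by positivity : 0 ≤ G * (1 + Real.sin ψ) * (1 + Real.sin φ))
      have e2 := mul_le_mul_of_nonneg_left (max_aux x y γla hxy)
        (mul_nonneg (mul_nonneg (by positivity) (by linarith)) (by linarith) :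
          0 ≤ (1 / 3) * G * (3 - Real.sin ψ) * (3 - Real.sin φ))
      rw [mul_add] at e1 e2
      linarith
    · have e1 := mul_le_mul_of_nonneg_left (max_aux x y γsr hxy)
        (mul_nonneg (mul_nonneg hG.le (by linarith)) (by linarith) :
          0 ≤ G * (1 - Real.sin ψ) * (1 - Real.sin φ))
      have e2 := mul_le_mul_of_nonneg_left (max_aux x y γra hxy)
        (by positivity : 0 ≤ (1 / 3) * G * (3 + Real.sin ψ) * (3 + Real.sin φ))
      rw [mul_add] at e1 e2
      linarith
end

section
/- Let G > 0 and ψ ∈ (0, π/2), and let σ₁ᵗʳ ≥ σ₂ᵗʳ ≥ σ₃ᵗʳ be real numbers. Then γ_la = λ·γ_sl + (1−λ)·γ_sr with λ = (1+sin ψ)/(3−sin ψ) ∈ (0,1), and γ_ra = μ·γ_sr + (1−μ)·γ_sl with μ = (1−sin ψ)/(3+sin ψ) ∈ (0,1); in particular both γ_la and γ_ra lie between γ_sl and γ_sr. Consequently, exactly one of the following two orderings holds: if γ_sl ≤ γ_sr then γ_sl ≤ γ_ra ≤ γ_la ≤ γ_sr, and if γ_sr ≤ γ_sl then γ_sr ≤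 γ_la ≤ γ_ra ≤ γ_sl. -/
/-- `γ_la` and `γ_ra` are convex combinations of `γ_sl` and `γ_sr` with
weights `λ = (1+sin ψ)/(3−sin ψ)` and `μ = (1−sin ψ)/(3+sin ψ)` in `(0,1)`; consequently
if `γ_sl ≤ γ_sr` then `γ_sl ≤ γ_ra ≤ γ_la ≤ γ_sr`, and if `γ_sr ≤ γ_sl` then
`γ_sr ≤ γ_la ≤ γ_ra ≤ γ_sl`. -/
theorem gamma_convex_combinations (G ψ : ℝ) (hG : 0 < G)
    (hψ : ψ ∈ Set.Ioo 0 (Real.pi / 2))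
    (σ1 σ2 σ3 : ℝ) (hord : σ2 ≤ σ1 ∧ σ3 ≤ σ2)
    (γsl γsr γla γra lam mu : ℝ)
    (hsl : γsl = (σ1 - σ2) / (2 * G * (1 + Real.sin ψ)))
    (hsr : γsr = (σ2 - σ3) / (2 * G * (1 - Real.sin ψ)))
    (hla : γla = (σ1 + σ2 - 2 * σ3) / (2 * G * (3 - Real.sin ψ)))
    (hra : γra = (2 * σ1 - σ2 - σ3) / (2 * G * (3 + Real.sin ψ)))
    (hlam : lam = (1 + Real.sin ψ) / (3 - Real.sin ψ))
    (hmu : mu = (1 - Real.sin ψ) / (3 + Real.sin ψ)) :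
    (0 < lam ∧ lam < 1 ∧ γla = lam * γsl + (1 - lam) * γsr) ∧
    (0 < mu ∧ mu < 1 ∧ γra = mu * γsr + (1 - mu) * γsl) ∧
    (γsl ≤ γsr → γsl ≤ γra ∧ γra ≤ γla ∧ γla ≤ γsr) ∧
    (γsr ≤ γsl → γsr ≤ γla ∧ γla ≤ γra ∧ γra ≤ γsl) := by
  have hs0 : 0 < Real.sin ψ :=
    Real.sin_pos_of_pos_of_lt_pi hψ.1 (by linarith [hψ.2, Real.pi_pos])
  have hs1 : Real.sin ψ < 1 := by
    have h := Real.sin_lt_sin_of_lt_of_le_pi_div_two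
      (by linarith [hψ.1, Real.pi_pos]) le_rfl hψ.2
    rwa [Real.sin_pi_div_two] at h
  generalize Real.sin ψ = s at *
  have p1 : 0 < 1 + s := by linarith
  have p2 : 0 < 1 - s := by linarith
  have p3 : 0 < 3 - s := by linarith
  have p4 : 0 < 3 + s := by linarith
  have l0 : 0 < lam := by rw [hlam]; positivity
  have l1 : lam < 1 := by rw [hlam, div_lt_one p3]; linarith
  have m0 : 0 < mu := by rw [hmu]; positivity
  have m1 : mu < 1 := by rw [hmu, div_lt_one p4]; linarith
  have lm : lam + mu ≤ 1 := by
    rw [hlam, hmu, div_add_div _ _ p3.ne' p4.ne', div_le_one (by positivity)]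
    nlinarith
  have n1 := p1.ne'
  have n2 := p2.ne'
  have n3 := p3.ne'
  have n4 := p4.ne'
  have ela : γla = lam * γsl + (1 - lam) * γsr := by
    rw [hla, hlam, hsl, hsr]
    field_simp
    ring
  have era : γra = mu * γsr + (1 - mu) * γsl := by
    rw [hra, hmu, hsl, hsr]
    field_simp
    ring
  refine ⟨⟨l0, l1, ela⟩, ⟨m0, m1, era⟩, fun h => ?_, fun h => ?_⟩
  · rw [ela, era]
    refine ⟨?_, ?_, ?_⟩
    · nlinarith [mul_nonneg m0.le (sub_nonneg.2 h)]
    · nlinarith [mul_nonneg (sub_nonneg.2 lm) (sub_nonneg.2 h)]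
    · nlinarith [mul_nonneg l0.le (sub_nonneg.2 h)]
  · rw [ela, era]
    refine ⟨?_, ?_, ?_⟩
    · nlinarith [mul_nonneg l0.le (sub_nonneg.2 h)]
    · nlinarith [mul_nonneg (sub_nonneg.2 lm) (sub_nonneg.2 h)]
    · nlinarith [mul_nonneg m0.le (sub_nonneg.2 h)]
end

section
/- Fix K, G > 0, c₀ > 0, φ, ψ ∈ (0, π/2), a nondecreasing continuous function H : ℝ → ℝ with H(0) = 0, real numbers σ₁ᵗʳ ≥ σ₂ᵗʳ ≥ σ₃ᵗʳ and ε̄ᵗʳ ∈ ℝ, and assume (1+sin φ)σ₁ᵗʳ − (1−sin φ)σ₃ᵗʳ − 2(c₀ + H(ε̄ᵗʳ))cos φ > 0. Then there exists exactly one quintuple of real numbers (σ₁, σ₂, σ₃, ε̄ᵖ, Δλ) with σ₁ ≥ σ₂ ≥ σ₃ and Δλ > 0 such that there exist real numbers ν₁, ν₂, ν₃ satisfying: 1+sin ψ ≥ ν₁ ≥ ν₂ ≥ ν₃ ≥ −1+sin ψ; ν₁+ν₂+ν₃ = 2 sin ψ; (ν₁−1−sin ψ)(σ₁−σ₂) =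 0; (ν₃+1−sin ψ)(σ₂−σ₃) = 0; σᵢ = σᵢᵗʳ − Δλ·[(2/3)(3K−2G)sin ψ + 2G·νᵢ] for i = 1,2,3; ε̄ᵖ = ε̄ᵗʳ + 2Δλ·cos φ; and (1+sin φ)σ₁ − (1−sin φ)σ₃ − 2(c₀+H(ε̄ᵖ))cos φ = 0. -/
/-- The plastic correction system written in principal stresses
(problem (20) of the paper), for given trial principal stresses
`σ1tr ≥ σ2tr ≥ σ3tr` and trial hardening variable `εtr`. -/
def PrincipalSystem (K G c₀ φ ψ : ℝ) (H : ℝ → ℝ) (σ1tr σ2tr σ3tr εtr : ℝ)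
    (σ₁ σ₂ σ₃ εp Δlam : ℝ) : Prop :=
  ∃ ν₁ ν₂ ν₃ : ℝ,
    ν₁ ≤ 1 + Real.sin ψ ∧ ν₂ ≤ ν₁ ∧ ν₃ ≤ ν₂ ∧ -1 + Real.sin ψ ≤ ν₃ ∧
    ν₁ + ν₂ + ν₃ = 2 * Real.sin ψ ∧
    (ν₁ - 1 - Real.sin ψ) * (σ₁ - σ₂) = 0 ∧
    (ν₃ + 1 - Real.sin ψ) * (σ₂ - σ₃) = 0 ∧
    σ₁ = σ1tr - Δlam * ((2 / 3) * (3 * K - 2 * G) * Real.sin ψ + 2 * G * ν₁) ∧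
    σ₂ = σ2tr - Δlam * ((2 / 3) * (3 * K - 2 * G) * Real.sin ψ + 2 * G * ν₂) ∧
    σ₃ = σ3tr - Δlam * ((2 / 3) * (3 * K - 2 * G) * Real.sin ψ + 2 * G * ν₃) ∧
    εp = εtr + 2 * Δlam * Real.cos φ ∧
    (1 + Real.sin φ) * σ₁ - (1 - Real.sin φ) * σ₃ - 2 * (c₀ + H εp) * Real.cos φ = 0

/-- Largest corrected stress (up to a shift). -/
noncomputable def topX (a b c p r : ℝ) : ℝ :=
  max (a - p) (max ((a + b - p) / 2) ((a + b + c - p + r) / 3))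

/-- Smallest corrected stress (up to a shift). -/
noncomputable def botX (a b c p r : ℝ) : ℝ :=
  min (c + r) (min ((b + c + r) / 2) ((a + b + c - p + r) / 3))

lemma topX_cases (a b c p r : ℝ) :
    (a - p ≤ topX a b c p r ∧ (a + b - p) / 2 ≤ topX a b c p r ∧
      (a + b + c - p + r) / 3 ≤ topX a b c p r) ∧
    (topX a b c p r = a - p ∨ topX a b c p r = (a + b - p) / 2 ∨
      topX a b c p r = (a + b + c - p + r) / 3) := by
  unfold topX; grind

lemma botX_cases (a b c p r : ℝ) :
    (botX a b c p r ≤ c + r ∧ botX a b c p r ≤ (b + c + r) / 2 ∧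
      botX a b c p r ≤ (a + b + c - p + r) / 3) ∧
    (botX a b c p r = c + r ∨ botX a b c p r = (b + c + r) / 2 ∨
      botX a b c p r = (a + b + c - p + r) / 3) := by
  unfold botX; grind

/-- The explicit formulas solve the correction problem. -/
lemma corr_exists (a b c p r X Y Z : ℝ) (hab : b ≤ a) (hbc : c ≤ b) (hp : 0 ≤ p) (hr : 0 ≤ r)
    (hX : X = topX a b c p r) (hZ : Z = botX a b c p r)
    (hY : X + Y + Z = a + b + c - p + r) :
    Y ≤ X ∧ Z ≤ Y ∧ b - Y ≤ a - X ∧ c - Z ≤ b - Y ∧ a - X ≤ p ∧ -r ≤ c - Z ∧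
      (a - X = p ∨ X = Y) ∧ (c - Z = -r ∨ Y = Z) := by
  obtain ⟨⟨h1, h2, h3⟩, h⟩ := topX_cases a b c p r
  obtain ⟨⟨k1, k2, k3⟩, k⟩ := botX_cases a b c p r
  rw [← hX] at h1 h2 h3 h
  rw [← hZ] at k1 k2 k3 k
  clear hX hZ
  rcases h with h | h | h <;> rcases k with k | k | k <;>
    refine ⟨by linarith, by linarith, by linarith, by linarith, by linarith, by linarith, ?_, ?_⟩ <;>
    first
    | (left; linarith)
    | (right; linarith)

/-- Any solution is given by the explicit formulas. -/
lemma corr_unique (a b c p r X Y Z : ℝ)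
    (hY : X + Y + Z = a + b + c - p + r) (h1 : Y ≤ X) (h2 : Z ≤ Y)
    (h3 : a - X ≤ p) (h4 : -r ≤ c - Z) (h5 : a - X = p ∨ X = Y) (h6 : c - Z = -r ∨ Y = Z) :
    X = topX a b c p r ∧ Z = botX a b c p r := by
  obtain ⟨⟨u1, u2, u3⟩, u⟩ := topX_cases a b c p r
  obtain ⟨⟨k1, k2, k3⟩, k⟩ := botX_cases a b c p r
  constructor
  · apply le_antisymm
    · rcases h5 with h5 | h5 <;> rcases h6 with h6 | h6 <;> linarith
    · rcases u with u | u | u <;> linarith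
  · apply le_antisymm
    · rcases k with k | k | k <;> linarith
    · rcases h5 with h5 | h5 <;> rcases h6 with h6 | h6 <;> linarith

lemma topX_anti (a b c s : ℝ) (hs0 : 0 ≤ s) (hs1 : s ≤ 1) (t u : ℝ) (h : t ≤ u) :
    topX a b c (u * (1 + s)) (u * (1 - s)) + 2 / 3 * s * u
      ≤ topX a b c (t * (1 + s)) (t * (1 - s)) + 2 / 3 * s * t := by
  obtain ⟨⟨h1, h2, h3⟩, -⟩ := topX_cases a b c (t * (1 + s)) (t * (1 - s))
  obtain ⟨-, k⟩ := topX_cases a b c (u * (1 + s)) (u * (1 - s))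
  have hm : 0 ≤ (u - t) * s := mul_nonneg (by linarith) hs0
  rcases k with k | k | k <;> nlinarith

lemma botX_mono (a b c s : ℝ) (hs0 : 0 ≤ s) (hs1 : s ≤ 1) (t u : ℝ) (h : t ≤ u) :
    botX a b c (t * (1 + s)) (t * (1 - s)) + 2 / 3 * s * t
      ≤ botX a b c (u * (1 + s)) (u * (1 - s)) + 2 / 3 * s * u := by
  obtain ⟨⟨h1, h2, h3⟩, -⟩ := botX_cases a b c (t * (1 + s)) (t * (1 - s))
  obtain ⟨-, k⟩ := botX_cases a b c (u * (1 + s)) (u * (1 - s))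
  have hm : 0 ≤ (u - t) * s := mul_nonneg (by linarith) hs0
  have hm' : 0 ≤ (u - t) * (1 - s) := mul_nonneg (by linarith) (by linarith)
  rcases k with k | k | k <;> nlinarith

/-- Theorem 4.4 of the paper: if the trial state is plastically
inadmissible, the plastic correction problem in principal stresses has exactly one
solution quintuple `(σ₁, σ₂, σ₃, ε̄ᵖ, Δλ)` with `σ₁ ≥ σ₂ ≥ σ₃` and `Δλ > 0`. -/
theorem plastic_correction_unique_solution
    (K G c₀ φ ψ : ℝ) (hK : 0 < K) (hG : 0 < G) (hc₀ : 0 < c₀)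
    (hφ : φ ∈ Set.Ioo 0 (Real.pi / 2)) (hψ : ψ ∈ Set.Ioo 0 (Real.pi / 2))
    (H : ℝ → ℝ) (hmono : Monotone H) (hcont : Continuous H) (hH0 : H 0 = 0)
    (σ1tr σ2tr σ3tr εtr : ℝ) (hord : σ2tr ≤ σ1tr ∧ σ3tr ≤ σ2tr)
    (hinadm : 0 < (1 + Real.sin φ) * σ1tr - (1 - Real.sin φ) * σ3tr
                - 2 * (c₀ + H εtr) * Real.cos φ) :
    ∃! p : ℝ × ℝ × ℝ × ℝ × ℝ,
      p.2.1 ≤ p.1 ∧ p.2.2.1 ≤ p.2.1 ∧ 0 < p.2.2.2.2 ∧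
      PrincipalSystem K G c₀ φ ψ H σ1tr σ2tr σ3tr εtr
        p.1 p.2.1 p.2.2.1 p.2.2.2.1 p.2.2.2.2 := by
  obtain ⟨hab, hbc⟩ := hord
  have hsφ : 0 < Real.sin φ := Real.sin_pos_of_pos_of_lt_pi hφ.1 (by linarith [hφ.2, Real.pi_pos])
  have hsψ : 0 < Real.sin ψ := Real.sin_pos_of_pos_of_lt_pi hψ.1 (by linarith [hψ.2, Real.pi_pos])
  have hcφ : 0 < Real.cos φ := Real.cos_pos_of_mem_Ioo ⟨by linarith [hφ.1, Real.pi_pos], hφ.2⟩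
  have hsφ1 : Real.sin φ ≤ 1 := Real.sin_le_one φ
  have hsψ1 : Real.sin ψ ≤ 1 := Real.sin_le_one ψ
  unfold PrincipalSystem
  generalize Real.sin φ = f at *
  generalize Real.cos φ = d at *
  generalize Real.sin ψ = s at *
  -- corrected stresses as functions of the multiplier
  obtain ⟨S1, hS1⟩ : ∃ S : ℝ → ℝ, ∀ t, S t =
    topX σ1tr σ2tr σ3tr (2 * G * t * (1 + s)) (2 * G * t * (1 - s))
      - t * ((2 / 3) * (3 * K - 2 * G) * s) := ⟨_, fun _ => rfl⟩
  obtain ⟨S3, hS3⟩ : ∃ S : ℝ → ℝ, ∀ t, S t =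
    botX σ1tr σ2tr σ3tr (2 * G * t * (1 + s)) (2 * G * t * (1 - s))
      - t * ((2 / 3) * (3 * K - 2 * G) * s) := ⟨_, fun _ => rfl⟩
  obtain ⟨q, hq⟩ : ∃ q : ℝ → ℝ, ∀ t, q t =
    (1 + f) * S1 t - (1 - f) * S3 t - 2 * (c₀ + H (εtr + 2 * t * d)) * d := ⟨_, fun _ => rfl⟩
  have hS1c : Continuous S1 := by
    rw [funext hS1]; unfold topX; fun_prop
  have hS3c : Continuous S3 := by
    rw [funext hS3]; unfold botX; fun_prop
  have hqc : Continuous q := by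
    rw [funext hq]; fun_prop
  have hS1a : ∀ t u, t ≤ u → S1 u + 2 * K * s * u ≤ S1 t + 2 * K * s * t := by
    intro t u h
    have := topX_anti σ1tr σ2tr σ3tr s hsψ.le hsψ1 (2 * G * t) (2 * G * u)
      (mul_le_mul_of_nonneg_left h (by linarith))
    rw [hS1, hS1]; linarith
  have hS3a : ∀ t u, t ≤ u → S3 t + 2 * K * s * t ≤ S3 u + 2 * K * s * u := by
    intro t u h
    have := botX_mono σ1tr σ2tr σ3tr s hsψ.le hsψ1 (2 * G * t) (2 * G * u)
      (mul_le_mul_of_nonneg_left h (by linarith))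
    rw [hS3, hS3]; linarith
  have hqa : ∀ t u, t ≤ u → q u + 4 * K * s * f * (u - t) ≤ q t := by
    intro t u h
    have e1 := mul_le_mul_of_nonneg_left (hS1a t u h) (by linarith : 0 ≤ 1 + f)
    have e2 := mul_le_mul_of_nonneg_left (hS3a t u h) (by linarith : 0 ≤ 1 - f)
    have hH : H (εtr + 2 * t * d) ≤ H (εtr + 2 * u * d) := by
      apply hmono
      have := mul_le_mul_of_nonneg_right h hcφ.le
      linarith
    have e3 := mul_le_mul_of_nonneg_right hH hcφ.le
    rw [hq, hq]; linarith
  have hC : 0 < 4 * K * s * f := by positivity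
  have hq0 : 0 < q 0 := by
    have e1 : σ1tr ≤ S1 0 := by
      have := (topX_cases σ1tr σ2tr σ3tr (2 * G * 0 * (1 + s)) (2 * G * 0 * (1 - s))).1.1
      rw [hS1]; linarith
    have e3 : S3 0 ≤ σ3tr := by
      have := (botX_cases σ1tr σ2tr σ3tr (2 * G * 0 * (1 + s)) (2 * G * 0 * (1 - s))).1.1
      rw [hS3]; linarith
    have e1' := mul_le_mul_of_nonneg_left e1 (by linarith : 0 ≤ 1 + f)
    have e3' := mul_le_mul_of_nonneg_left e3 (by linarith : 0 ≤ 1 - f)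
    have e : εtr + 2 * 0 * d = εtr := by ring
    rw [hq, e]; linarith
  obtain ⟨t, ht0, hqt⟩ : ∃ t, 0 < t ∧ q t = 0 := by
    have hT : 0 ≤ q 0 / (4 * K * s * f) := by positivity
    have hqT : q (q 0 / (4 * K * s * f)) ≤ 0 := by
      have h := hqa 0 _ hT
      have : 4 * K * s * f * (q 0 / (4 * K * s * f) - 0) = q 0 := by
        field_simp
        ring
      linarith
    obtain ⟨t, ht, hqt⟩ := intermediate_value_Icc' hT hqc.continuousOn ⟨hqT, hq0.le⟩
    refine ⟨t, lt_of_le_of_ne ht.1 ?_, hqt⟩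
    rintro rfl
    linarith
  have huniq : ∀ u, q u = 0 → u = t := by
    intro u hu
    rcases lt_trichotomy u t with h | h | h
    · have := hqa u t h.le
      have := mul_pos hC (sub_pos.2 h)
      linarith
    · exact h
    · have := hqa t u h.le
      have := mul_pos hC (sub_pos.2 h)
      linarith
  have hS2 : ∀ u x1 x2 x3 : ℝ, x1 = S1 u → x3 = S3 u →
      x1 + x2 + x3 = σ1tr + σ2tr + σ3tr - 6 * K * s * u →
      x2 = σ1tr + σ2tr + σ3tr - 6 * K * s * u - S1 u - S3 u := by
    intro u x1 x2 x3 h1 h3 h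
    linarith
  refine ⟨(S1 t, σ1tr + σ2tr + σ3tr - 6 * K * s * t - S1 t - S3 t, S3 t, εtr + 2 * t * d, t),
    ?_, ?_⟩
  · have hτ : 0 < 2 * G * t := by positivity
    obtain ⟨X, hX⟩ : ∃ X, X = topX σ1tr σ2tr σ3tr (2 * G * t * (1 + s)) (2 * G * t * (1 - s)) :=
      ⟨_, rfl⟩
    obtain ⟨Z, hZ⟩ : ∃ Z, Z = botX σ1tr σ2tr σ3tr (2 * G * t * (1 + s)) (2 * G * t * (1 - s)) :=
      ⟨_, rfl⟩
    obtain ⟨Y, hY⟩ : ∃ Y, X + Y + Z = σ1tr + σ2tr + σ3tr - 2 * G * t * (1 + s)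
        + 2 * G * t * (1 - s) := ⟨σ1tr + σ2tr + σ3tr - 2 * G * t * (1 + s)
        + 2 * G * t * (1 - s) - X - Z, by ring⟩
    obtain ⟨g1, g2, g3, g4, g5, g6, g7, g8⟩ := corr_exists σ1tr σ2tr σ3tr _ _ X Y Z hab hbc
      (mul_nonneg hτ.le (by linarith)) (mul_nonneg hτ.le (by linarith)) hX hZ hY
    have s1 := hS1 t
    have s3 := hS3 t
    rw [← hX] at s1
    rw [← hZ] at s3
    obtain ⟨n1, hn1⟩ : ∃ n, σ1tr - X = 2 * G * t * n := ⟨(σ1tr - X) / (2 * G * t), by field_simp⟩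
    obtain ⟨n2, hn2⟩ : ∃ n, σ2tr - Y = 2 * G * t * n := ⟨(σ2tr - Y) / (2 * G * t), by field_simp⟩
    obtain ⟨n3, hn3⟩ : ∃ n, σ3tr - Z = 2 * G * t * n := ⟨(σ3tr - Z) / (2 * G * t), by field_simp⟩
    rw [hn1] at g3 g5 g7
    rw [hn2] at g3 g4
    rw [hn3] at g4 g6 g8
    refine ⟨?_, ?_, ht0, n1, n2, n3, le_of_mul_le_mul_left g5 hτ, le_of_mul_le_mul_left g3 hτ,
      le_of_mul_le_mul_left g4 hτ, le_of_mul_le_mul_left (by linarith) hτ,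
      mul_left_cancel₀ hτ.ne' (by linarith), ?_, ?_, ?_, ?_, ?_, rfl, ?_⟩ <;> dsimp only
    · linarith
    · linarith
    · rcases g7 with g | g
      · have := mul_left_cancel₀ hτ.ne' g
        rw [this]; ring
      · apply mul_eq_zero_of_right; linarith
    · rcases g8 with g | g
      · have : n3 = -(1 - s) := mul_left_cancel₀ hτ.ne' (by linarith)
        rw [this]; ring
      · apply mul_eq_zero_of_right; linarith
    · linarith
    · linarith
    · linarith
    · rw [← hq]; exact hqt
  · rintro ⟨x1, x2, x3, e, u⟩ ⟨h21, h32, hu, n1, n2, n3, i1, i2, i3, i4, hsum, c1, c3, r1, r2, r3,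
      re, hyield⟩
    dsimp only at *
    have hτ : 0 < 2 * G * u := by positivity
    have hsum' : 2 * G * u * (n1 + n2 + n3) = 2 * G * u * (2 * s) := by rw [hsum]
    have i1' := mul_le_mul_of_nonneg_left i1 hτ.le
    have i4' := mul_le_mul_of_nonneg_left i4 hτ.le
    obtain ⟨m, hm⟩ : ∃ m, m = u * ((2 / 3) * (3 * K - 2 * G) * s) := ⟨_, rfl⟩
    have key := corr_unique σ1tr σ2tr σ3tr (2 * G * u * (1 + s)) (2 * G * u * (1 - s))
      (x1 + m) (x2 + m) (x3 + m) (by linarith) (by linarith) (by linarith) (by linarith)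
      (by linarith)
      (by
        rcases mul_eq_zero.1 c1 with h | h
        · left
          have : n1 = 1 + s := by linarith
          rw [this] at r1
          linarith
        · right; linarith)
      (by
        rcases mul_eq_zero.1 c3 with h | h
        · left
          have : n3 = -1 + s := by linarith
          rw [this] at r3
          linarith
        · right; linarith)
    have k1 : x1 = S1 u := by rw [hS1, ← key.1, hm]; ring
    have k3 : x3 = S3 u := by rw [hS3, ← key.2, hm]; ring
    have hut : u = t := by
      apply huniq
      rw [hq, ← k1, ← k3, ← re]; exact hyield
    have k2 := hS2 u x1 x2 x3 k1 k3 (by linarith)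
    rw [hut] at k1 k2 k3 re
    rw [k1, k2, k3, re, hut]
end

section
/- Fix K, G > 0, c₀ > 0, φ, ψ ∈ (0, π/2), a nondecreasing continuous function H : ℝ → ℝ with H(0) = 0, real numbers σ₁ᵗʳ ≥ σ₂ᵗʳ ≥ σ₃ᵗʳ and ε̄ᵗʳ ∈ ℝ. Assume q_s(0) = (1+sin φ)σ₁ᵗʳ − (1−sin φ)σ₃ᵗʳ − 2(c₀ + H(ε̄ᵗʳ))cos φ > 0 and q_s(min{γ_sl, γ_sr}) < 0. Then σ₁ᵗʳ > σ₂ᵗʳ > σ₃ᵗʳ, the equation q_s(Δλ) = 0 has a unique solution Δλ in the interval (0, min{γ_sl, γ_sr}), and the quantities σ₁ = σ₁ᵗʳ − Δλ[(2/3)(3K−2G)sin ψ + 2G(1+sin ψ)], σ₂ = σ₂ᵗʳ − Δλ·(2/3)(3K−2G)sin ψ, σ₃ = σ₃ᵗʳ − Δλ[(2/3)(3K−2G)sin ψ − 2G(1−sin ψ)], together with ε̄ᵖ = ε̄ᵗʳ + 2Δλ·cos φ, satisfy σ₁ > σ₂ > σ₃ and (1+sin φ)σ₁ − (1−sin φ)σ₃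 − 2(c₀+H(ε̄ᵖ))cos φ = 0 (the return to the smooth portion of the Mohr–Coulomb pyramid). -/
/-- return to the smooth portion: if `q_s(0) > 0` and
`q_s(min{γ_sl, γ_sr}) < 0`, then `σ₁ᵗʳ > σ₂ᵗʳ > σ₃ᵗʳ`, the equation `q_s(Δλ) = 0` has a
unique solution in `(0, min{γ_sl, γ_sr})`, and the corrected principal stresses are
strictly ordered and lie on the yield surface. -/
theorem return_to_smooth_portion
    (K G c₀ φ ψ : ℝ) (hK : 0 < K) (hG : 0 < G) (hc₀ : 0 < c₀)
    (hφ : φ ∈ Set.Ioo 0 (Real.pi / 2)) (hψ : ψ ∈ Set.Ioo 0 (Real.pi / 2))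
    (H : ℝ → ℝ) (hmono : Monotone H) (hcont : Continuous H) (hH0 : H 0 = 0)
    (σ1 σ2 σ3 εtr : ℝ) (hord : σ2 ≤ σ1 ∧ σ3 ≤ σ2)
    (γsl γsr : ℝ)
    (hsl : γsl = (σ1 - σ2) / (2 * G * (1 + Real.sin ψ)))
    (hsr : γsr = (σ2 - σ3) / (2 * G * (1 - Real.sin ψ)))
    (qs : ℝ → ℝ)
    (hqs : ∀ γ : ℝ, qs γ =
      (1 + Real.sin φ) * σ1 - (1 - Real.sin φ) * σ3
        - 2 * (c₀ + H (εtr + 2 * γ * Real.cos φ)) * Real.cos φ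
        - γ * ((4 / 3) * (3 * K - 2 * G) * Real.sin ψ * Real.sin φ
                + 4 * G * (1 + Real.sin ψ * Real.sin φ)))
    (hq0 : 0 < qs 0)
    (hqmin : qs (min γsl γsr) < 0) :
    (σ2 < σ1 ∧ σ3 < σ2) ∧
    ∃ Δlam σ₁ σ₂ σ₃ εp : ℝ,
      0 < Δlam ∧ Δlam < min γsl γsr ∧ qs Δlam = 0 ∧
      (∀ γ : ℝ, 0 < γ → γ < min γsl γsr → qs γ = 0 → γ = Δlam) ∧
      σ₁ = σ1 - Δlam * ((2 / 3) * (3 * K - 2 * G) * Real.sin ψ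
              + 2 * G * (1 + Real.sin ψ)) ∧
      σ₂ = σ2 - Δlam * ((2 / 3) * (3 * K - 2 * G) * Real.sin ψ) ∧
      σ₃ = σ3 - Δlam * ((2 / 3) * (3 * K - 2 * G) * Real.sin ψ
              - 2 * G * (1 - Real.sin ψ)) ∧
      εp = εtr + 2 * Δlam * Real.cos φ ∧
      σ₂ < σ₁ ∧ σ₃ < σ₂ ∧
      (1 + Real.sin φ) * σ₁ - (1 - Real.sin φ) * σ₃
        - 2 * (c₀ + H εp) * Real.cos φ = 0 := by
  have hp0 : 0 < Real.sin ψ :=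
    Real.sin_pos_of_pos_of_lt_pi hψ.1 (by linarith [hψ.2, Real.pi_pos])
  have hs0 : 0 < Real.sin φ :=
    Real.sin_pos_of_pos_of_lt_pi hφ.1 (by linarith [hφ.2, Real.pi_pos])
  have hcφ : 0 < Real.cos φ :=
    Real.cos_pos_of_mem_Ioo ⟨by linarith [hφ.1, Real.pi_pos], hφ.2⟩
  have hcψ : 0 < Real.cos ψ :=
    Real.cos_pos_of_mem_Ioo ⟨by linarith [hψ.1, Real.pi_pos], hψ.2⟩
  have hp1 : Real.sin ψ < 1 := by
    nlinarith [Real.sin_sq_add_cos_sq ψ, pow_pos hcψ 2]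
  have hdl : 0 < 2 * G * (1 + Real.sin ψ) := by positivity
  have hdr : 0 < 2 * G * (1 - Real.sin ψ) := mul_pos (by positivity) (by linarith)
  have hC : 0 < (4 / 3) * (3 * K - 2 * G) * Real.sin ψ * Real.sin φ
                + 4 * G * (1 + Real.sin ψ * Real.sin φ) := by
    have h1 := mul_pos hK (mul_pos hp0 hs0)
    have h2 := mul_pos hG (mul_pos hp0 hs0)
    nlinarith
  have hanti : StrictAnti qs := by
    intro a b hab
    rw [hqs a, hqs b]
    have h1 : H (εtr + 2 * a * Real.cos φ) ≤ H (εtr + 2 * b * Real.cos φ) :=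
      hmono (by nlinarith)
    have h2 := mul_le_mul_of_nonneg_right h1 hcφ.le
    have h3 := mul_lt_mul_of_pos_right hab hC
    linarith
  have hqc : Continuous qs := by
    rw [funext hqs]
    fun_prop
  have hm : 0 < min γsl γsr := by
    by_contra h
    have := hanti.antitone (not_lt.mp h)
    linarith
  obtain ⟨hl, hr⟩ := lt_min_iff.mp hm
  obtain ⟨d, hd, hqd⟩ :=
    intermediate_value_Ioo' hm.le hqc.continuousOn ⟨hqmin, hq0⟩
  obtain ⟨hdl', hdr'⟩ := lt_min_iff.mp hd.2
  have e1 := hdl'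
  have e2 := hdr'
  rw [hsl, lt_div_iff₀ hdl] at e1
  rw [hsr, lt_div_iff₀ hdr] at e2
  have f1 := mul_pos hd.1 hdl
  have f2 := mul_pos hd.1 hdr
  refine ⟨⟨by linarith, by linarith⟩, d, _, _, _, _, hd.1, hd.2, hqd, ?_,
    rfl, rfl, rfl, rfl, by linarith, by linarith, ?_⟩
  · intro γ _ _ h
    exact hanti.injective (h.trans hqd.symm)
  · rw [hqs d] at hqd
    linarith
end

section
/- Fix K, G > 0, c₀ > 0, φ, ψ ∈ (0, π/2), a nondecreasing continuous function H : ℝ → ℝ with H(0) = 0, real numbers σ₁ᵗʳ ≥ σ₂ᵗʳ ≥ σ₃ᵗʳ and ε̄ᵗʳ ∈ ℝ. Assume (1+sin φ)σ₁ᵗʳ − (1−sin φ)σ₃ᵗʳ − 2(c₀ + H(ε̄ᵗʳ))cos φ > 0 and q_a(max{γ_la, γ_ra}) ≥ 0. Then the equation q_a(Δλ) = 0 has a unique solution Δλ in the interval [max{γ_la, γ_ra}, ∞), and setting p = (σ₁ᵗʳ+σ₂ᵗʳ+σ₃ᵗʳ)/3 − 2K·Δλ·sin ψ and ε̄ᵖ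 = ε̄ᵗʳ + 2Δλ·cos φ, one has 2p·sin φ − 2(c₀+H(ε̄ᵖ))cos φ = 0 (the return to the apex, with σ₁ = σ₂ = σ₃ = p). Moreover, Δλ and p depend on the trial principal stresses only through the sum σ₁ᵗʳ+σ₂ᵗʳ+σ₃ᵗʳ: if two trial triples have the same sum and the same ε̄ᵗʳ and both satisfy the above hypotheses, the resulting Δλ and p coincide. -/
/-- The apex branch function `q_a` of the incremental Mohr–Coulomb problem; it depends on
the trial principal stresses only through their sum `s = σ₁ᵗʳ + σ₂ᵗʳ + σ₃ᵗʳ`. -/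
noncomputable def qa (K c₀ φ ψ : ℝ) (H : ℝ → ℝ) (s εtr γ : ℝ) : ℝ :=
  (2 / 3) * s * Real.sin φ
    - 2 * (c₀ + H (εtr + 2 * γ * Real.cos φ)) * Real.cos φ
    - 4 * γ * K * Real.sin ψ * Real.sin φ

theorem qa_decr (K c₀ φ ψ : ℝ) (hφ : φ ∈ Set.Ioo 0 (Real.pi / 2))
    (H : ℝ → ℝ) (hmono : Monotone H) (s εtr x y : ℝ) (hxy : x ≤ y) :
    qa K c₀ φ ψ H s εtr y + 4 * K * Real.sin ψ * Real.sin φ * (y - x)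
      ≤ qa K c₀ φ ψ H s εtr x := by
  have hc : 0 < Real.cos φ :=
    Real.cos_pos_of_mem_Ioo ⟨by linarith [hφ.1, Real.pi_pos], hφ.2⟩
  have h1 : H (εtr + 2 * x * Real.cos φ) ≤ H (εtr + 2 * y * Real.cos φ) := by
    apply hmono
    nlinarith
  unfold qa
  nlinarith [mul_le_mul_of_nonneg_right h1 hc.le]

/-- return to the apex: if the trial state is plastically inadmissible and
`q_a(max{γ_la, γ_ra}) ≥ 0`, then `q_a(Δλ) = 0` has a unique solution
`Δλ ∈ [max{γ_la, γ_ra}, ∞)`; the hydrostatic stress `p = (σ₁ᵗʳ+σ₂ᵗʳ+σ₃ᵗʳ)/3 − 2KΔλ sin ψ`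
satisfies the yield condition at the apex; and `Δλ`, `p` depend on the trial principal
stresses only through their sum. -/
theorem return_to_apex
    (K G c₀ φ ψ : ℝ) (hK : 0 < K) (hG : 0 < G) (hc₀ : 0 < c₀)
    (hφ : φ ∈ Set.Ioo 0 (Real.pi / 2)) (hψ : ψ ∈ Set.Ioo 0 (Real.pi / 2))
    (H : ℝ → ℝ) (hmono : Monotone H) (hcont : Continuous H) (hH0 : H 0 = 0)
    (σ1 σ2 σ3 εtr : ℝ) (hord : σ2 ≤ σ1 ∧ σ3 ≤ σ2)
    (γla γra : ℝ)
    (hla : γla = (σ1 + σ2 - 2 * σ3) / (2 * G * (3 - Real.sin ψ)))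
    (hra : γra = (2 * σ1 - σ2 - σ3) / (2 * G * (3 + Real.sin ψ)))
    (hinadm : 0 < (1 + Real.sin φ) * σ1 - (1 - Real.sin φ) * σ3
                - 2 * (c₀ + H εtr) * Real.cos φ)
    (hqa0 : 0 ≤ qa K c₀ φ ψ H (σ1 + σ2 + σ3) εtr (max γla γra)) :
    (∃ Δlam : ℝ, max γla γra ≤ Δlam ∧ qa K c₀ φ ψ H (σ1 + σ2 + σ3) εtr Δlam = 0 ∧
      (∀ γ : ℝ, max γla γra ≤ γ → qa K c₀ φ ψ H (σ1 + σ2 + σ3) εtr γ = 0 → γ = Δlam) ∧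
      2 * ((σ1 + σ2 + σ3) / 3 - 2 * K * Δlam * Real.sin ψ) * Real.sin φ
        - 2 * (c₀ + H (εtr + 2 * Δlam * Real.cos φ)) * Real.cos φ = 0)
    ∧
    -- invariance with respect to trial triples having the same sum (and the same εtr)
    (∀ σ1' σ2' σ3' γla' γra' : ℝ, σ2' ≤ σ1' → σ3' ≤ σ2' →
      γla' = (σ1' + σ2' - 2 * σ3') / (2 * G * (3 - Real.sin ψ)) →
      γra' = (2 * σ1' - σ2' - σ3') / (2 * G * (3 + Real.sin ψ)) →
      0 < (1 + Real.sin φ) * σ1' - (1 - Real.sin φ) * σ3'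
          - 2 * (c₀ + H εtr) * Real.cos φ →
      0 ≤ qa K c₀ φ ψ H (σ1' + σ2' + σ3') εtr (max γla' γra') →
      σ1' + σ2' + σ3' = σ1 + σ2 + σ3 →
      ∀ Δlam Δlam' : ℝ,
        (max γla γra ≤ Δlam ∧ qa K c₀ φ ψ H (σ1 + σ2 + σ3) εtr Δlam = 0) →
        (max γla' γra' ≤ Δlam' ∧ qa K c₀ φ ψ H (σ1' + σ2' + σ3') εtr Δlam' = 0) →
        Δlam = Δlam' ∧
        (σ1 + σ2 + σ3) / 3 - 2 * K * Δlam * Real.sin ψ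
          = (σ1' + σ2' + σ3') / 3 - 2 * K * Δlam' * Real.sin ψ) := by
  have hsφ : 0 < Real.sin φ :=
    Real.sin_pos_of_pos_of_lt_pi hφ.1 (by linarith [hφ.2, Real.pi_pos])
  have hsψ : 0 < Real.sin ψ :=
    Real.sin_pos_of_pos_of_lt_pi hψ.1 (by linarith [hψ.2, Real.pi_pos])
  have hC : 0 < 4 * K * Real.sin ψ * Real.sin φ := by positivity
  have huniq : ∀ s x y : ℝ, qa K c₀ φ ψ H s εtr x = 0 → qa K c₀ φ ψ H s εtr y = 0 →
      x = y := by
    intro s x y hx hy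
    rcases lt_trichotomy x y with h | h | h
    · have h1 := qa_decr K c₀ φ ψ hφ H hmono s εtr x y h.le
      have h2 := mul_pos hC (sub_pos.2 h)
      linarith
    · exact h
    · have h1 := qa_decr K c₀ φ ψ hφ H hmono s εtr y x h.le
      have h2 := mul_pos hC (sub_pos.2 h)
      linarith
  refine ⟨?_, ?_⟩
  · generalize max γla γra = m at *
    generalize σ1 + σ2 + σ3 = s at *
    have hq : Continuous (qa K c₀ φ ψ H s εtr) := by
      unfold qa
      fun_prop
    set M := m + qa K c₀ φ ψ H s εtr m / (4 * K * Real.sin ψ * Real.sin φ) with hM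
    have hmM : m ≤ M := by
      have := div_nonneg hqa0 hC.le
      linarith
    have hqM : qa K c₀ φ ψ H s εtr M ≤ 0 := by
      have h1 := qa_decr K c₀ φ ψ hφ H hmono s εtr m M hmM
      have h2 : 4 * K * Real.sin ψ * Real.sin φ * (M - m) = qa K c₀ φ ψ H s εtr m := by
        rw [hM, add_sub_cancel_left, mul_div_cancel₀ _ hC.ne']
      linarith
    obtain ⟨x, hx, hx0⟩ := intermediate_value_Icc' hmM hq.continuousOn ⟨hqM, hqa0⟩
    refine ⟨x, hx.1, hx0, fun γ _ h => huniq s γ x h hx0, ?_⟩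
    unfold qa at hx0
    linarith
  · intro σ1' σ2' σ3' γla' γra' _ _ _ _ _ _ hs x y hx hy
    rw [hs] at hy ⊢
    have := huniq _ x y hx.2 hy.2
    subst this
    exact ⟨rfl, rfl⟩
end

section
/- Fix K ∈ ℝ, G > 0, ψ ∈ (0, π/2), real numbers σ₁ᵗʳ ≥ σ₂ᵗʳ ≥ σ₃ᵗʳ and Δλ > 0. Let ν₁, ν₂, ν₃ be real numbers with ν₃ = −(1−sin ψ), ν₁ + ν₂ = 1 + sin ψ, and 1+sin ψ ≥ ν₁ ≥ ν₂ ≥ 0, and define σᵢ = σᵢᵗʳ − Δλ·[(2/3)(3K−2G)sin ψ + 2G·νᵢ] for i = 1,2,3. If σ₁ = σ₂ > σ₃ (return to the left edge), then σ₂ᵗʳ > σ₃ᵗʳ and γ_sl ≤ Δλ < γ_la, where γ_sl = (σ₁ᵗʳ−σ₂ᵗʳ)/(2G(1+sin ψ)) and γ_la = (σ₁ᵗʳ+σ₂ᵗʳ−2σ₃ᵗʳ)/(2G(3−sin ψ)). -/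
/-- return to the left edge: with `ν₃ = −(1−sin ψ)`, `ν₁ + ν₂ = 1 + sin ψ`,
`1 + sin ψ ≥ ν₁ ≥ ν₂ ≥ 0` and `σᵢ = σᵢᵗʳ − Δλ·[(2/3)(3K−2G)sin ψ + 2G·νᵢ]`, if
`σ₁ = σ₂ > σ₃`, then `σ₂ᵗʳ > σ₃ᵗʳ` and `γ_sl ≤ Δλ < γ_la`. -/
theorem return_to_left_edge_bounds
    (K G ψ : ℝ) (hG : 0 < G) (hψ : ψ ∈ Set.Ioo 0 (Real.pi / 2))
    (σ1tr σ2tr σ3tr : ℝ) (hord : σ2tr ≤ σ1tr ∧ σ3tr ≤ σ2tr)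
    (Δlam : ℝ) (hΔlam : 0 < Δlam)
    (ν₁ ν₂ ν₃ : ℝ)
    (hν₃ : ν₃ = -(1 - Real.sin ψ))
    (hν₁₂ : ν₁ + ν₂ = 1 + Real.sin ψ)
    (hν : ν₁ ≤ 1 + Real.sin ψ ∧ ν₂ ≤ ν₁ ∧ 0 ≤ ν₂)
    (σ₁ σ₂ σ₃ : ℝ)
    (h1 : σ₁ = σ1tr - Δlam * ((2 / 3) * (3 * K - 2 * G) * Real.sin ψ + 2 * G * ν₁))
    (h2 : σ₂ = σ2tr - Δlam * ((2 / 3) * (3 * K - 2 * G) * Real.sin ψ + 2 * G * ν₂))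
    (h3 : σ₃ = σ3tr - Δlam * ((2 / 3) * (3 * K - 2 * G) * Real.sin ψ + 2 * G * ν₃))
    (hedge : σ₁ = σ₂ ∧ σ₃ < σ₂)
    (γsl γla : ℝ)
    (hsl : γsl = (σ1tr - σ2tr) / (2 * G * (1 + Real.sin ψ)))
    (hla : γla = (σ1tr + σ2tr - 2 * σ3tr) / (2 * G * (3 - Real.sin ψ))) :
    σ3tr < σ2tr ∧ γsl ≤ Δlam ∧ Δlam < γla := by
  have hs0 : 0 < Real.sin ψ :=
    Real.sin_pos_of_pos_of_lt_pi hψ.1 (by linarith [hψ.2, Real.pi_pos])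
  have hs1 : Real.sin ψ ≤ 1 := Real.sin_le_one ψ
  obtain ⟨e1, e2⟩ := hedge
  obtain ⟨_, hν21, hν2⟩ := hν
  generalize Real.sin ψ = s at *
  have hp : 0 < Δlam * (2 * G) := by positivity
  have a12 : σ1tr - σ2tr = Δlam * (2 * G) * (ν₁ - ν₂) := by
    rw [h1, h2] at e1
    linarith
  have a23 : Δlam * (2 * G) * (ν₂ - ν₃) < σ2tr - σ3tr := by
    rw [h2, h3] at e2
    linarith
  refine ⟨?_, ?_, ?_⟩
  · have : 0 ≤ Δlam * (2 * G) * (ν₂ - ν₃) := mul_nonneg hp.le (by linarith)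
    linarith
  · rw [hsl, div_le_iff₀ (by positivity), a12]
    have : Δlam * (2 * G) * (ν₁ - ν₂) ≤ Δlam * (2 * G) * (1 + s) :=
      mul_le_mul_of_nonneg_left (by linarith) hp.le
    linarith
  · have h3s : 0 < 3 - s := by linarith
    rw [hla, lt_div_iff₀ (by positivity)]
    have : Δlam * (2 * G * (3 - s)) =
        Δlam * (2 * G) * (ν₁ - ν₂) + 2 * (Δlam * (2 * G) * (ν₂ - ν₃)) := by
      have : 3 - s = (ν₁ - ν₂) + 2 * (ν₂ - ν₃) := by linarith
      rw [this]
      ring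
    linarith
end

section
/- Let G > 0, φ, ψ ∈ (0, π/2), and let σ₁ᵗʳ ≥ σ₂ᵗʳ ≥ σ₃ᵗʳ be real numbers with γ_sl = γ_sr. Then γ_la = γ_ra, and for every γ ≥ 0: G(1+sin ψ)(1+sin φ)·max(γ−γ_sl, 0) + (1/3)G(3−sin ψ)(3−sin φ)·max(γ−γ_la, 0) = G(1−sin ψ)(1−sin φ)·max(γ−γ_sr, 0) + (1/3)G(3+sin ψ)(3+sin φ)·max(γ−γ_ra, 0); hence the two piecewise formulas defining the function q of the incremental Mohr–Coulomb problem coincide when γ_sl = γ_sr. -/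
/-- if `γ_sl = γ_sr`, then `γ_la = γ_ra` and the two kink terms of the two
piecewise formulas for `q` coincide for every `γ ≥ 0`; hence the two formulas defining
`q` agree when `γ_sl = γ_sr`. -/
theorem q_formulas_coincide
    (G φ ψ : ℝ) (hG : 0 < G)
    (hφ : φ ∈ Set.Ioo 0 (Real.pi / 2)) (hψ : ψ ∈ Set.Ioo 0 (Real.pi / 2))
    (σ1 σ2 σ3 : ℝ) (hord : σ2 ≤ σ1 ∧ σ3 ≤ σ2)
    (γsl γsr γla γra : ℝ)
    (hsl : γsl = (σ1 - σ2) / (2 * G * (1 + Real.sin ψ)))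
    (hsr : γsr = (σ2 - σ3) / (2 * G * (1 - Real.sin ψ)))
    (hla : γla = (σ1 + σ2 - 2 * σ3) / (2 * G * (3 - Real.sin ψ)))
    (hra : γra = (2 * σ1 - σ2 - σ3) / (2 * G * (3 + Real.sin ψ)))
    (heq : γsl = γsr) :
    γla = γra ∧
    ∀ γ : ℝ, 0 ≤ γ →
      G * (1 + Real.sin ψ) * (1 + Real.sin φ) * max (γ - γsl) 0
        + (1 / 3) * G * (3 - Real.sin ψ) * (3 - Real.sin φ) * max (γ - γla) 0
      = G * (1 - Real.sin ψ) * (1 - Real.sin φ) * max (γ - γsr) 0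
        + (1 / 3) * G * (3 + Real.sin ψ) * (3 + Real.sin φ) * max (γ - γra) 0 := by
  have hs0 : 0 < Real.sin ψ := Real.sin_pos_of_pos_of_lt_pi hψ.1 (by linarith [hψ.1, hψ.2])
  have hs1 : Real.sin ψ < 1 := by
    have h := Real.sin_lt_sin_of_lt_of_le_pi_div_two (x := ψ) (y := Real.pi / 2)
      (by linarith [hψ.1, hψ.2]) le_rfl hψ.2
    rwa [Real.sin_pi_div_two] at h
  have p1 : 2 * G * (1 + Real.sin ψ) ≠ 0 := (mul_pos (by linarith) (by linarith)).ne'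
  have p2 : 2 * G * (1 - Real.sin ψ) ≠ 0 := (mul_pos (by linarith) (by linarith)).ne'
  have p3 : 2 * G * (3 - Real.sin ψ) ≠ 0 := (mul_pos (by linarith) (by linarith)).ne'
  have p4 : 2 * G * (3 + Real.sin ψ) ≠ 0 := (mul_pos (by linarith) (by linarith)).ne'
  rw [eq_div_iff p1] at hsl
  rw [eq_div_iff p2, ← heq] at hsr
  have ela : γla = γsl := by
    rw [hla, div_eq_iff p3]
    linear_combination -hsl - 2 * hsr
  have era : γra = γsl := by
    rw [hra, div_eq_iff p4]
    linear_combination -2 * hsl - hsr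
  refine ⟨ela.trans era.symm, fun γ _ => ?_⟩
  rw [ela, era, ← heq]
  ring
end
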